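/- arXiv:0804.2109 — 8 statements merged into one kernel-verified Lean document; each statement's English description precedes it below -/
import Mathlib

section
/- Let 𝒜₁ and 𝒜₂ be boolean independent subalgebras of 𝒜 with respect to φ. If n, m ≥ 0, X ∈ 𝒜₁, Y ∈ 𝒜₂, and a₁, …, aₙ, a_{n+3}, …, a_{n+m+2} ∈ 𝒜₁ ∨ 𝒜₂, then the boolean cumulant with X and Y in two consecutive positions vanishes: b^{n+m+2}(a₁, …, aₙ, X, Y, a_{n+3}, …, a_{n+m+2}) = 0. -/
/-- `b` is the family of boolean cumulants of the unital linear functional `φ`: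
for a nonempty list `a₁, …, aₙ` of elements of `A`,
`φ (a₁ ⋯ aₙ) = ∑_{k=1}^{n} b(a₁,…,a_k) ⬝ φ (a_{k+1} ⋯ aₙ)`,
the empty product having `φ`-value `φ 1 = 1`. -/
def IsBooleanCumulant {A C : Type*} [Ring A] [Algebra ℂ A] [Ring C] [Algebra ℂ C]
    (φ : A →ₗ[ℂ] C) (b : List A → C) : Prop :=
  ∀ l : List A, l ≠ [] →
    φ l.prod = ∑ k ∈ Finset.range l.length,
      b (l.take (k + 1)) * φ ((l.drop (k + 1)).prod)

/-- Two (not necessarily unital) subalgebras `A1, A2` of `A` are boolean independent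
with respect to `φ` if for every nonempty alternating word (consecutive letters lying
in different subalgebras among `A1`, `A2`), `φ` of the product is the ordered product
of the individual `φ`-values. -/
def BooleanIndep {A C : Type*} [Ring A] [Algebra ℂ A] [Ring C] [Algebra ℂ C]
    (φ : A →ₗ[ℂ] C) (A1 A2 : NonUnitalSubalgebra ℂ A) : Prop :=
  ∀ l : List A, l ≠ [] →
    (∀ x ∈ l, x ∈ A1 ∨ x ∈ A2) →
    l.Chain' (fun x y => (x ∈ A1 ∧ y ∈ A2) ∨ (x ∈ A2 ∧ y ∈ A1)) →
    φ l.prod = (l.map φ).prod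

/-- A word followed by a letter of `B` regroups to an alternating word ending in `B`. -/
theorem exists_alternating_of_word_mul {A : Type*} [Ring A] [Algebra ℂ A]
    (w : List A) (B D : NonUnitalSubalgebra ℂ A) (hw : ∀ a ∈ w, a ∈ B ∨ a ∈ D)
    (x : A) (hx : x ∈ B) :
    ∃ (l : List A) (z : A), z ∈ B ∧ (∀ a ∈ l ++ [z], a ∈ B ∨ a ∈ D) ∧
      (l ++ [z]).IsChain (fun x y => (x ∈ B ∧ y ∈ D) ∨ (x ∈ D ∧ y ∈ B)) ∧
      (l ++ [z]).prod = w.prod * x := by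
  induction w using List.reverseRecOn generalizing B D x with
  | nil => exact ⟨[], x, hx, by simp [hx], by simp, by simp⟩
  | append_singleton w a ih =>
    have hw' : ∀ c ∈ w, c ∈ B ∨ c ∈ D := fun c hc => hw c (by simp [hc])
    rcases hw a (by simp) with ha | ha
    · obtain ⟨l, z, hz, hmem, hchain, hprod⟩ := ih B D hw' (a * x) (mul_mem ha hx)
      exact ⟨l, z, hz, hmem, hchain, by simp [hprod, mul_assoc]⟩
    · obtain ⟨l, z, hz, hmem, hchain, hprod⟩ :=
        ih D B (fun c hc => (hw' c hc).symm) a ha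
      refine ⟨l ++ [z], x, hx, ?_, ?_, ?_⟩
      · intro c hc
        rcases List.mem_append.1 hc with hc | hc
        · exact (hmem c hc).symm
        · exact Or.inl (by simpa [List.mem_singleton.1 hc] using hx)
      · refine List.IsChain.append (hchain.imp fun _ _ h => h.symm) (by simp) ?_
        simp [hz, hx]
      · rw [List.prod_append, hprod]
        simp

/-- A letter of `B` followed by a word regroups to an alternating word starting in `B`. -/
theorem exists_alternating_of_mul_word {A : Type*} [Ring A] [Algebra ℂ A]
    (w : List A) (B D : NonUnitalSubalgebra ℂ A) (hw : ∀ a ∈ w, a ∈ B ∨ a ∈ D)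
    (x : A) (hx : x ∈ B) :
    ∃ (z : A) (l : List A), z ∈ B ∧ (∀ a ∈ z :: l, a ∈ B ∨ a ∈ D) ∧
      (z :: l).IsChain (fun x y => (x ∈ B ∧ y ∈ D) ∨ (x ∈ D ∧ y ∈ B)) ∧
      (z :: l).prod = x * w.prod := by
  induction w generalizing B D x with
  | nil => exact ⟨x, [], hx, by simp [hx], by simp, by simp⟩
  | cons a w ih =>
    have hw' : ∀ c ∈ w, c ∈ B ∨ c ∈ D := fun c hc => hw c (by simp [hc])
    rcases hw a (by simp) with ha | ha
    · obtain ⟨z, l, hz, hmem, hchain, hprod⟩ := ih B D hw' (x * a) (mul_mem hx ha)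
      exact ⟨z, l, hz, hmem, hchain, by rw [hprod, List.prod_cons, mul_assoc]⟩
    · obtain ⟨z, l, hz, hmem, hchain, hprod⟩ :=
        ih D B (fun c hc => (hw' c hc).symm) a ha
      refine ⟨x, z :: l, hx, ?_, ?_, ?_⟩
      · intro c hc
        rcases List.mem_cons.1 hc with rfl | hc
        · exact Or.inl hx
        · exact (hmem c hc).symm
      · exact List.IsChain.cons_cons (Or.inl ⟨hx, hz⟩) (hchain.imp fun _ _ h => h.symm)
      · rw [List.prod_cons, hprod, List.prod_cons]

theorem BooleanIndep.map_words_mul {A C : Type*} [Ring A] [Algebra ℂ A] [Ring C] [Algebra ℂ C]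
    {φ : A →ₗ[ℂ] C} {A1 A2 : NonUnitalSubalgebra ℂ A} (h : BooleanIndep φ A1 A2)
    {X Y : A} (hX : X ∈ A1) (hY : Y ∈ A2) (p q : List A)
    (hp : ∀ a ∈ p, a ∈ A1 ∨ a ∈ A2) (hq : ∀ a ∈ q, a ∈ A1 ∨ a ∈ A2) :
    φ ((p.prod * X) * (Y * q.prod)) = φ (p.prod * X) * φ (Y * q.prod) := by
  obtain ⟨l, x, hx, hmem, hchain, hprod⟩ := exists_alternating_of_word_mul p A1 A2 hp X hX
  obtain ⟨y, r, hy, hmem', hchain', hprod'⟩ :=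
    exists_alternating_of_mul_word q A2 A1 (fun a ha => (hq a ha).symm) Y hY
  replace hmem' : ∀ a ∈ y :: r, a ∈ A1 ∨ a ∈ A2 := fun a ha => (hmem' a ha).symm
  replace hchain' := hchain'.imp fun _ _ h => h.symm
  rw [← hprod, ← hprod', ← List.prod_append, h _ (by simp) ?_ ?_, h _ (by simp) hmem hchain,
    h _ (by simp) hmem' hchain', List.map_append, List.prod_append]
  · intro a ha
    exact (List.mem_append.1 ha).elim (hmem a) (hmem' a)
  · refine List.IsChain.append hchain hchain' ?_
    simp [hx, hy]

theorem BooleanIndep.map_mul {A C : Type*} [Ring A] [Algebra ℂ A] [Ring C] [Algebra ℂ C]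
    {φ : A →ₗ[ℂ] C} {A1 A2 : NonUnitalSubalgebra ℂ A} (h : BooleanIndep φ A1 A2)
    {X Y : A} (hX : X ∈ A1) (hY : Y ∈ A2) {P Q : A}
    (hP : P ∈ Algebra.adjoin ℂ (A1 ∪ A2 : Set A)) (hQ : Q ∈ Algebra.adjoin ℂ (A1 ∪ A2 : Set A)) :
    φ ((P * X) * (Y * Q)) = φ (P * X) * φ (Y * Q) := by
  rw [← Subalgebra.mem_toSubmodule, Algebra.adjoin_eq_span] at hP hQ
  induction hP using Submodule.span_induction with
  | zero => simp
  | add P₁ P₂ _ _ h₁ h₂ => simp only [add_mul, _root_.map_add, h₁, h₂]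
  | smul c P _ h₁ => simp only [smul_mul_assoc, _root_.map_smul, h₁]
  | mem P hP =>
    induction hQ using Submodule.span_induction with
    | zero => simp
    | add Q₁ Q₂ _ _ h₁ h₂ => simp only [mul_add, _root_.map_add, h₁, h₂]
    | smul c Q _ h₁ => simp only [mul_smul_comm, _root_.map_smul, h₁]
    | mem Q hQ =>
      obtain ⟨p, hp, rfl⟩ := Submonoid.exists_list_of_mem_closure hP
      obtain ⟨q, hq, rfl⟩ := Submonoid.exists_list_of_mem_closure hQ
      exact h.map_words_mul hX hY p q hp hq

theorem list_prod_mem_adjoin_union {A : Type*} [Ring A] [Algebra ℂ A]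
    {A1 A2 : NonUnitalSubalgebra ℂ A} {l : List A} (hl : ∀ a ∈ l, a ∈ A1 ⊔ A2) :
    l.prod ∈ Algebra.adjoin ℂ (A1 ∪ A2 : Set A) := by
  have hle : A1 ⊔ A2 ≤ (Algebra.adjoin ℂ (A1 ∪ A2 : Set A)).toNonUnitalSubalgebra :=
    sup_le (fun a ha => Algebra.subset_adjoin (Or.inl ha))
      (fun a ha => Algebra.subset_adjoin (Or.inr ha))
  exact list_prod_mem fun a ha => hle (hl a ha)

/-- Proposition 3.1: a boolean cumulant with `X ∈ A1` and `Y ∈ A2` in two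
consecutive positions (the other entries lying in the subalgebra generated by
`A1` and `A2`) vanishes. -/
theorem boolean_cumulant_consecutive_indep_vanish
    {A C : Type*} [Ring A] [Algebra ℂ A] [Ring C] [Algebra ℂ C]
    (φ : A →ₗ[ℂ] C) (hφ : φ 1 = 1)
    (A1 A2 : NonUnitalSubalgebra ℂ A) (hindep : BooleanIndep φ A1 A2)
    (b : List A → C) (hb : IsBooleanCumulant φ b)
    (X Y : A) (hX : X ∈ A1) (hY : Y ∈ A2)
    (u v : List A) (hu : ∀ a ∈ u, a ∈ A1 ⊔ A2) (hv : ∀ a ∈ v, a ∈ A1 ⊔ A2) :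
    b (u ++ X :: Y :: v) = 0 := by
  induction hn : v.length using Nat.strong_induction_on generalizing v with
  | _ n ih =>
  subst hn
  have hsplit : ∀ k < u.length + 1,
      φ (((u ++ [X]).drop (k + 1)).prod * (Y :: v).prod) =
        φ ((u ++ [X]).drop (k + 1)).prod * φ (Y :: v).prod := by
    intro k hk
    rcases Nat.lt_or_ge k u.length with hk' | hk'
    · rw [List.drop_append_of_le_length hk', List.prod_append, List.prod_singleton, List.prod_cons]
      exact hindep.map_mul hX hY
        (list_prod_mem_adjoin_union fun a ha => hu a (List.mem_of_mem_drop ha))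
        (list_prod_mem_adjoin_union hv)
    · rw [List.drop_eq_nil_of_le (by simpa using hk')]
      simp [hφ]
  have hfactor : φ ((u ++ [X]).prod * (Y :: v).prod) =
      φ (u ++ [X]).prod * φ (Y :: v).prod := by
    rw [List.prod_append, List.prod_singleton, List.prod_cons]
    exact hindep.map_mul hX hY (list_prod_mem_adjoin_union hu) (list_prod_mem_adjoin_union hv)
  have hrec := hb ((u ++ [X]) ++ Y :: v) (by simp)
  have hlen : ((u ++ [X]) ++ Y :: v).length = (u.length + 1) + (v.length + 1) := by simp; omega
  rw [hlen, Finset.sum_range_add, Finset.sum_range_succ (n := v.length), List.prod_append,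
    hfactor, hb (u ++ [X]) (by simp), Finset.sum_mul] at hrec
  have hhead : ∀ k ∈ Finset.range (u.length + 1),
      b (((u ++ [X]) ++ Y :: v).take (k + 1)) * φ (((u ++ [X]) ++ Y :: v).drop (k + 1)).prod =
        b ((u ++ [X]).take (k + 1)) * φ ((u ++ [X]).drop (k + 1)).prod * φ (Y :: v).prod := by
    intro k hk
    have hk := Finset.mem_range.1 hk
    have hle : k + 1 ≤ (u ++ [X]).length := by simpa using hk
    rw [List.take_append_of_le_length hle, List.drop_append_of_le_length hle, List.prod_append,
      hsplit k hk, mul_assoc]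
  have htail : ∀ k ∈ Finset.range v.length,
      b (((u ++ [X]) ++ Y :: v).take (u.length + 1 + k + 1)) *
        φ (((u ++ [X]) ++ Y :: v).drop (u.length + 1 + k + 1)).prod = 0 := by
    intro k hk
    have hk := Finset.mem_range.1 hk
    have htake : ((u ++ [X]) ++ Y :: v).take (u.length + 1 + k + 1) =
        u ++ X :: Y :: v.take k := by
      have : u.length + 1 + k + 1 = (u ++ [X]).length + (k + 1) := by simp; omega
      rw [this, List.take_length_add_append]
      simp
    rw [htake, ih _ (by simpa using hk) (v.take k)
      (fun a ha => hv a (List.mem_of_mem_take ha)) rfl, zero_mul]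
  rw [Finset.sum_congr rfl hhead, Finset.sum_eq_zero htail, zero_add,
    List.take_of_length_le (by simp; omega), List.drop_eq_nil_of_le (by simp; omega),
    List.prod_nil, hφ, mul_one] at hrec
  simpa using hrec
end

section
/- For every n ≥ 2, all a₁, …, aₙ ∈ 𝒜 and every interior position 1 ≤ k ≤ n−1, inserting the unit between a_k and a_{k+1} does not change the boolean cumulant: b^{n+1}(a₁, …, a_k, 1, a_{k+1}, …, aₙ) = b^n(a₁, …, aₙ). -/
/-- The defining recursion for a concatenation, with the sum split at the junction. -/
theorem IsBooleanCumulant.map_prod_append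
    {A C : Type*} [Ring A] [Algebra ℂ A] [Ring C] [Algebra ℂ C]
    {φ : A →ₗ[ℂ] C} {b : List A → C} (hb : IsBooleanCumulant φ b)
    {u : List A} (hu : u ≠ []) (v : List A) :
    φ (u ++ v).prod =
      ∑ k ∈ Finset.range u.length, b (u.take (k + 1)) * φ (u.drop (k + 1) ++ v).prod +
      ∑ j ∈ Finset.range v.length, b (u ++ v.take (j + 1)) * φ (v.drop (j + 1)).prod := by
  rw [hb (u ++ v) (by simp [hu]), List.length_append, Finset.sum_range_add]
  congr 1
  · refine Finset.sum_congr rfl fun k hk => ?_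
    have hk : k + 1 ≤ u.length := Finset.mem_range.mp hk
    rw [List.take_append_of_le_length hk, List.drop_append_of_le_length hk]
  · refine Finset.sum_congr rfl fun j _ => ?_
    rw [add_assoc, List.take_length_add_append, List.drop_length_add_append]

/-- A boolean cumulant of order at least two vanishes when its last argument is `1`. -/
theorem IsBooleanCumulant.append_one_eq_zero
    {A C : Type*} [Ring A] [Algebra ℂ A] [Ring C] [Algebra ℂ C]
    {φ : A →ₗ[ℂ] C} (hφ : φ 1 = 1) {b : List A → C} (hb : IsBooleanCumulant φ b)
    {u : List A} (hu : u ≠ []) : b (u ++ [1]) = 0 := by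
  have h := hb.map_prod_append hu [1]
  have h' := hb u hu
  simp only [List.prod_append, List.prod_singleton, mul_one] at h
  rw [h'] at h
  simpa [hφ] using h

/-- Proposition 3.3 (iii): inserting the unit `1` in an interior position does not
change the boolean cumulant:
`b^{n+1}(a₁, …, a_k, 1, a_{k+1}, …, aₙ) = b^n(a₁, …, aₙ)` for `n ≥ 2`, `1 ≤ k ≤ n-1`.
Here `u = (a₁,…,a_k)` and `v = (a_{k+1},…,aₙ)` are nonempty. -/
theorem boolean_cumulant_one_interior
    {A C : Type*} [Ring A] [Algebra ℂ A] [Ring C] [Algebra ℂ C]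
    (φ : A →ₗ[ℂ] C) (hφ : φ 1 = 1)
    (b : List A → C) (hb : IsBooleanCumulant φ b)
    (u v : List A) (hu : u ≠ []) (hv : v ≠ []) :
    b (u ++ 1 :: v) = b (u ++ v) := by
  induction hn : v.length using Nat.strong_induction_on generalizing v with
  | _ n ih =>
    obtain ⟨m, rfl⟩ : ∃ m, n = m + 1 :=
      Nat.exists_eq_succ_of_ne_zero (by simpa [← hn] using hv)
    have h₁ := hb.map_prod_append hu (1 :: v)
    have h₂ := hb.map_prod_append hu v
    simp only [List.prod_append, List.prod_cons, one_mul, List.length_cons] at h₁ h₂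
    rw [h₂, add_right_inj, Finset.sum_range_succ', hn] at h₁
    simp only [List.take_succ_cons, List.drop_succ_cons, List.take_zero,
      hb.append_one_eq_zero hφ hu, zero_mul, add_zero] at h₁
    rw [Finset.sum_range_succ, Finset.sum_range_succ] at h₁
    have h_sum : ∑ j ∈ Finset.range m,
          b (u ++ 1 :: v.take (j + 1)) * φ (v.drop (j + 1)).prod =
        ∑ j ∈ Finset.range m, b (u ++ v.take (j + 1)) * φ (v.drop (j + 1)).prod := by
      refine Finset.sum_congr rfl fun j hj => ?_
      have hj : j < m := Finset.mem_range.mp hj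
      rw [ih (j + 1) (by omega) (v.take (j + 1)) (by simp [hv])
        (by rw [List.length_take]; omega)]
    rw [h_sum, add_right_inj, ← hn, List.take_length, List.drop_length, List.prod_nil,
      hφ, mul_one, mul_one] at h₁
    exact h₁.symm
end

section
/- For every X ∈ 𝒜 one has b^1_{1+X} = 1 + b^1_X, and for every n ≥ 2 the boolean cumulants of 1+X are given by b^n_{1+X} = Σ_{k=0}^{n−2} C(n−2, k) · b^{k+2}_X, where C(n−2,k) denotes the binomial coefficient. -/
open Polynomial in
/-- The linear map on polynomials sending `X ^ n` to `f n`. -/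
noncomputable def Polynomial.umbral {C : Type*} [Ring C] [Algebra ℂ C] (f : ℕ → C) :
    ℂ[X] →ₗ[ℂ] C :=
  (Polynomial.basisMonomials ℂ).constr ℂ f

open Polynomial in
theorem Polynomial.umbral_X_pow {C : Type*} [Ring C] [Algebra ℂ C] (f : ℕ → C) (n : ℕ) :
    umbral f (X ^ n) = f n := by
  have h := (Polynomial.basisMonomials ℂ).constr_basis ℂ f n
  rw [Polynomial.coe_basisMonomials] at h
  rwa [← Polynomial.monomial_one_right_eq_X_pow]

open Polynomial in
theorem Polynomial.linearMap_ext_X_pow {C : Type*} [Ring C] [Algebra ℂ C]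
    {f g : ℂ[X] →ₗ[ℂ] C} (h : ∀ n : ℕ, f (X ^ n) = g (X ^ n)) : f = g := by
  refine (Polynomial.basisMonomials ℂ).ext fun n => ?_
  simpa [Polynomial.monomial_one_right_eq_X_pow] using h n

open Polynomial in
/-- The functional `q ↦ (β ⊗ m) ((p ⊗ 1) ∂q)`, where `∂` is the free difference quotient. -/
noncomputable def Polynomial.differenceQuotient {C : Type*} [Ring C] [Algebra ℂ C]
    (β m : ℂ[X] →ₗ[ℂ] C) (p : ℂ[X]) : ℂ[X] →ₗ[ℂ] C :=
  umbral fun n => ∑ k ∈ Finset.range n, β (X ^ k * p) * m (X ^ (n - 1 - k))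

open Polynomial in
theorem Polynomial.differenceQuotient_X_mul {C : Type*} [Ring C] [Algebra ℂ C]
    (β m : ℂ[X] →ₗ[ℂ] C) (p q : ℂ[X]) :
    differenceQuotient β m p (X * q) = β p * m q + differenceQuotient β m (X * p) q := by
  suffices h : differenceQuotient β m p ∘ₗ LinearMap.mulLeft ℂ X =
      LinearMap.mulLeft ℂ (β p) ∘ₗ m + differenceQuotient β m (X * p) from
    LinearMap.congr_fun h q
  refine linearMap_ext_X_pow fun n => ?_
  simp only [LinearMap.comp_apply, LinearMap.add_apply, LinearMap.mulLeft_apply,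
    differenceQuotient, ← pow_succ', umbral_X_pow]
  rw [Finset.sum_range_succ', add_comm]
  congr 1
  · simp
  · refine Finset.sum_congr rfl fun k _ => ?_
    rw [pow_succ, mul_assoc, show n + 1 - 1 - (k + 1) = n - 1 - k by omega]

open Polynomial in
theorem Polynomial.differenceQuotient_add {C : Type*} [Ring C] [Algebra ℂ C]
    (β m : ℂ[X] →ₗ[ℂ] C) (p₁ p₂ : ℂ[X]) :
    differenceQuotient β m (p₁ + p₂) =
      differenceQuotient β m p₁ + differenceQuotient β m p₂ := by
  refine linearMap_ext_X_pow fun n => ?_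
  simp only [LinearMap.add_apply, differenceQuotient, umbral_X_pow, mul_add, map_add, add_mul,
    Finset.sum_add_distrib]

open Polynomial in
theorem Polynomial.differenceQuotient_one_add_X_pow {C : Type*} [Ring C] [Algebra ℂ C]
    (β m : ℂ[X] →ₗ[ℂ] C) (n : ℕ) (p : ℂ[X]) :
    differenceQuotient β m p ((1 + X) ^ n) =
      ∑ k ∈ Finset.range n, β ((1 + X) ^ k * p) * m ((1 + X) ^ (n - 1 - k)) := by
  induction n generalizing p with
  | zero => rw [pow_zero, ← pow_zero (X : ℂ[X]), differenceQuotient, umbral_X_pow, Finset.sum_range_zero,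
      Finset.sum_range_zero]
  | succ n ih =>
    have h : differenceQuotient β m p ((1 + X) ^ (n + 1)) =
        β p * m ((1 + X) ^ n) + differenceQuotient β m ((1 + X) * p) ((1 + X) ^ n) := by
      rw [pow_succ', add_mul, one_mul, map_add, differenceQuotient_X_mul, add_mul, one_mul,
        differenceQuotient_add, LinearMap.add_apply]
      abel
    rw [h, ih, Finset.sum_range_succ', add_comm]
    congr 1
    · refine Finset.sum_congr rfl fun k _ => ?_
      rw [pow_succ, mul_assoc, show n + 1 - 1 - (k + 1) = n - 1 - k by omega]
    · simp

theorem IsBooleanCumulant.map_pow {A C : Type*} [Ring A] [Algebra ℂ A] [Ring C] [Algebra ℂ C]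
    {φ : A →ₗ[ℂ] C} {b : List A → C} (hb : IsBooleanCumulant φ b) (a : A) (n : ℕ) :
    φ (a ^ (n + 1)) =
      ∑ k ∈ Finset.range (n + 1), b (List.replicate (k + 1) a) * φ (a ^ (n - k)) := by
  have h := hb (List.replicate (n + 1) a) (by simp)
  rw [List.prod_replicate, List.length_replicate] at h
  rw [h]
  refine Finset.sum_congr rfl fun k hk => ?_
  have hk' := Finset.mem_range.mp hk
  rw [List.take_replicate, List.drop_replicate, List.prod_replicate, min_eq_left (by omega),
    show n + 1 - (k + 1) = n - k by omega]

theorem eq_of_sum_mul_eq {C : Type*} [Ring C] {f g M : ℕ → C} (hM : M 0 = 1)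
    (h : ∀ n, ∑ k ∈ Finset.range (n + 1), f k * M (n - k) =
      ∑ k ∈ Finset.range (n + 1), g k * M (n - k)) : f = g := by
  funext n
  induction n using Nat.strong_induction_on with
  | _ n ih =>
    have hn := h n
    rw [Finset.sum_range_succ, Finset.sum_range_succ,
      Finset.sum_congr rfl fun k hk => by rw [ih k (Finset.mem_range.mp hk)]] at hn
    simpa [hM] using hn

open Polynomial in
theorem IsBooleanCumulant.map_one_add_pow {A C : Type*} [Ring A] [Algebra ℂ A] [Ring C]
    [Algebra ℂ C] {φ : A →ₗ[ℂ] C} (hφ : φ 1 = 1) {b : List A → C}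
    (hb : IsBooleanCumulant φ b) (a : A) (n : ℕ) :
    φ ((1 + a) ^ n) = 1 + ∑ k ∈ Finset.range n,
      umbral (fun j => b (List.replicate (j + 1) a)) ((1 + X) ^ k) *
        φ ((1 + a) ^ (n - 1 - k)) := by
  let β : ℂ[X] →ₗ[ℂ] C := umbral fun j => b (List.replicate (j + 1) a)
  let m : ℂ[X] →ₗ[ℂ] C := φ ∘ₗ (aeval a).toLinearMap
  have key : m = umbral (fun j => if j = 0 then 1 else 0) + differenceQuotient β m 1 := by
    refine linearMap_ext_X_pow fun n => ?_
    rw [LinearMap.add_apply, differenceQuotient, umbral_X_pow, umbral_X_pow]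
    cases n with
    | zero => simp [m, hφ]
    | succ n => simp [m, β, umbral_X_pow, hb.map_pow]
  have const : umbral (fun j => if j = 0 then (1 : C) else 0) =
      (Algebra.linearMap ℂ C) ∘ₗ (aeval (0 : ℂ)).toLinearMap := by
    refine linearMap_ext_X_pow fun n => ?_
    rw [umbral_X_pow]
    cases n <;> simp
  have h := LinearMap.congr_fun key ((1 + X) ^ n)
  rw [LinearMap.add_apply, const, differenceQuotient_one_add_X_pow] at h
  simpa [m, β] using h

/-- Corollary 3.4: `b¹_{1+X} = 1 + b¹_X`, and for `n ≥ 2`,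
`b^n_{1+X} = ∑_{k=0}^{n-2} C(n-2, k) • b^{k+2}_X`. -/
theorem boolean_cumulant_one_plus_X
    {A C : Type*} [Ring A] [Algebra ℂ A] [Ring C] [Algebra ℂ C]
    (φ : A →ₗ[ℂ] C) (hφ : φ 1 = 1)
    (b : List A → C) (hb : IsBooleanCumulant φ b)
    (X : A) :
    b [1 + X] = 1 + b [X] ∧
    ∀ n : ℕ, 2 ≤ n →
      b (List.replicate n (1 + X)) =
        ∑ k ∈ Finset.range (n - 1), (n - 2).choose k • b (List.replicate (k + 2) X) := by
  let β := Polynomial.umbral fun j => b (List.replicate (j + 1) X)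
  let B : ℕ → C := fun k => β ((1 + Polynomial.X) ^ k)
  let g : ℕ → C := fun k => if k = 0 then 1 + B 0 else B k - B (k - 1)
  have hM : ∀ n, φ ((1 + X) ^ n) =
      1 + ∑ k ∈ Finset.range n, B k * φ ((1 + X) ^ (n - 1 - k)) := hb.map_one_add_pow hφ X
  have main : (fun k => b (List.replicate (k + 1) (1 + X))) = g := by
    refine eq_of_sum_mul_eq (M := fun n => φ ((1 + X) ^ n)) (by simpa using hφ) fun n => ?_
    rw [← hb.map_pow, hM (n + 1), Finset.sum_range_succ', Finset.sum_range_succ']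
    have hg : ∀ k ∈ Finset.range n, g (k + 1) * φ ((1 + X) ^ (n - (k + 1))) =
        B (k + 1) * φ ((1 + X) ^ (n - (k + 1))) - B k * φ ((1 + X) ^ (n - 1 - k)) := by
      intro k _
      simp only [g, Nat.succ_ne_zero, if_false, Nat.add_sub_cancel, sub_mul,
        show n - (k + 1) = n - 1 - k by omega]
    rw [Finset.sum_congr rfl hg, Finset.sum_sub_distrib]
    simp only [g, if_true, Nat.add_sub_cancel, Nat.sub_zero, add_mul, one_mul]
    rw [← sub_eq_iff_eq_add'.mpr (hM n)]
    abel
  refine ⟨?_, fun n hn => ?_⟩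
  · have hβ : B 0 = b [X] := by
      simpa [B, β] using Polynomial.umbral_X_pow (fun j => b (List.replicate (j + 1) X)) 0
    simpa [g, hβ] using congrFun main 0
  · obtain ⟨n, rfl⟩ := Nat.exists_eq_add_of_le' hn
    have h := congrFun main (n + 1)
    simp only [g, Nat.succ_ne_zero, if_false, Nat.add_sub_cancel] at h
    rw [h]
    simp only [B]
    rw [← map_sub, pow_succ, mul_add, mul_one, add_sub_cancel_left, add_comm (1 : Polynomial ℂ),
      add_pow, Finset.sum_mul, map_sum]
    refine Finset.sum_congr rfl fun k _ => ?_
    rw [one_pow, mul_one, mul_right_comm, ← pow_succ, ← nsmul_eq_mul', map_nsmul,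
      Polynomial.umbral_X_pow]
    rfl
end

section
/- Let 𝒜₁ and 𝒜₂ be boolean independent subalgebras of 𝒜 with respect to φ, X ∈ 𝒜₁, Y ∈ 𝒜₂, and a₁, …, aₙ ∈ 𝒜₁ ∨ 𝒜₂ (n ≥ 0). Then for every 0 ≤ k ≤ n the boolean cumulant with two consecutive entries equal to XY vanishes: b^{n+2}(a₁, …, a_k, XY, XY, a_{k+1}, …, aₙ) = 0. -/
/-- `IsAltWord S i j l` says that the nonempty word `l` has letters taken alternately from
`S true` and `S false`, the first one from `S i` and the last one from `S j`. -/
inductive IsAltWord {A : Type*} [Ring A] [Algebra ℂ A] (S : Bool → NonUnitalSubalgebra ℂ A) :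
    Bool → Bool → List A → Prop
  | single {i : Bool} {x : A} (hx : x ∈ S i) : IsAltWord S i i [x]
  | cons {i j : Bool} {x : A} {l : List A} (hx : x ∈ S i) (hl : IsAltWord S (!i) j l) :
      IsAltWord S i j (x :: l)

namespace IsAltWord

variable {A C : Type*} [Ring A] [Algebra ℂ A] [Ring C] [Algebra ℂ C]
  {S : Bool → NonUnitalSubalgebra ℂ A} {i j k : Bool} {l m : List A}

theorem append (hl : IsAltWord S i j l) (hm : IsAltWord S (!j) k m) :
    IsAltWord S i k (l ++ m) := by
  induction hl with
  | single hx => exact .cons hx hm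
  | cons hx _ ih => exact .cons hx (ih hm)

theorem exists_mul_left (hl : IsAltWord S i j l) {a : A} (ha : a ∈ S k) :
    ∃ i' l', IsAltWord S i' j l' ∧ l'.prod = a * l.prod := by
  by_cases hk : k = i
  · subst hk
    cases hl with
    | single hx => exact ⟨_, _, .single (mul_mem ha hx), by simp⟩
    | cons hx hl => exact ⟨_, _, .cons (mul_mem ha hx) hl, by simp [mul_assoc]⟩
  · obtain rfl : i = !k := by cases i <;> cases k <;> simp_all
    exact ⟨k, a :: l, .cons ha hl, by simp⟩

theorem exists_mul_right (hl : IsAltWord S i j l) {a : A} (ha : a ∈ S k) :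
    ∃ j' l', IsAltWord S i j' l' ∧ l'.prod = l.prod * a := by
  induction hl with
  | @single i x hx =>
    by_cases hk : k = i
    · subst hk
      exact ⟨_, _, .single (mul_mem hx ha), by simp⟩
    · obtain rfl : k = !i := by cases i <;> cases k <;> simp_all
      exact ⟨_, _, .cons hx (.single ha), by simp⟩
  | cons hx _ ih =>
    obtain ⟨j', l', hl', e⟩ := ih
    exact ⟨j', _, .cons hx hl', by simp [e, mul_assoc]⟩

theorem ne_nil (hl : IsAltWord S i j l) : l ≠ [] := by
  cases hl <;> simp

theorem exists_mem (hl : IsAltWord S i j l) : ∀ x ∈ l, ∃ i, x ∈ S i := by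
  induction hl with
  | single hx => exact List.forall_mem_singleton.2 ⟨_, hx⟩
  | cons hx _ ih => exact List.forall_mem_cons.2 ⟨⟨_, hx⟩, ih⟩

theorem isChain (hl : IsAltWord S i j l) :
    l.IsChain (fun x y => ∃ i, x ∈ S i ∧ y ∈ S (!i)) := by
  induction hl with
  | single hx => simp
  | cons hx hl ih =>
    cases hl with
    | single hy => exact List.isChain_pair.2 ⟨_, hx, hy⟩
    | cons hy hl => exact List.isChain_cons_cons.2 ⟨⟨_, hx, hy⟩, ih⟩

theorem map_prod {φ : A →ₗ[ℂ] C} (hindep : BooleanIndep φ (S true) (S false))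
    (hl : IsAltWord S i j l) :
    φ l.prod = (l.map φ).prod := by
  refine hindep l hl.ne_nil (fun x hx => ?_) (hl.isChain.imp fun x y h => ?_)
  · obtain ⟨i, hi⟩ := hl.exists_mem x hx
    cases i
    · exact .inr hi
    · exact .inl hi
  · obtain ⟨i, hi⟩ := h
    cases i
    · exact .inr hi
    · exact .inl hi

end IsAltWord

section Span

variable {A C : Type*} [Ring A] [Algebra ℂ A] [Ring C] [Algebra ℂ C]

/-- The span of the products of alternating words whose last letter is in `S j`. -/
def altSpanRight (S : Bool → NonUnitalSubalgebra ℂ A) (j : Bool) : Submodule ℂ A :=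
  Submodule.span ℂ {w | ∃ i l, IsAltWord S i j l ∧ l.prod = w}

/-- The span of the products of alternating words whose first letter is in `S i`. -/
def altSpanLeft (S : Bool → NonUnitalSubalgebra ℂ A) (i : Bool) : Submodule ℂ A :=
  Submodule.span ℂ {w | ∃ j l, IsAltWord S i j l ∧ l.prod = w}

variable {S : Bool → NonUnitalSubalgebra ℂ A} {i j : Bool}

theorem mul_mem_altSpanRight {a w : A} (ha : a ∈ S true ⊔ S false)
    (hw : w ∈ altSpanRight S j) : a * w ∈ altSpanRight S j := by
  have gen : ∀ k, ∀ a ∈ S k, ∀ w ∈ altSpanRight S j, a * w ∈ altSpanRight S j := by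
    intro k a ha w hw
    induction hw using Submodule.span_induction with
    | mem w hw =>
      obtain ⟨i, l, hl, rfl⟩ := hw
      obtain ⟨i', l', hl', e⟩ := hl.exists_mul_left ha
      exact Submodule.subset_span ⟨i', l', hl', e⟩
    | zero => simp
    | add x y _ _ hx hy => rw [mul_add]; exact add_mem hx hy
    | smul c x _ hx => rw [mul_smul_comm]; exact Submodule.smul_mem _ c hx
  let T : NonUnitalSubalgebra ℂ A :=
    { carrier := {a | ∀ w ∈ altSpanRight S j, a * w ∈ altSpanRight S j}
      add_mem' := fun ha hb w hw => by rw [add_mul]; exact add_mem (ha w hw) (hb w hw)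
      zero_mem' := fun w _ => by simp
      mul_mem' := fun ha hb w hw => by rw [mul_assoc]; exact ha _ (hb w hw)
      smul_mem' := fun c a ha w hw => by
        rw [smul_mul_assoc]; exact Submodule.smul_mem _ c (ha w hw) }
  exact (sup_le (gen true) (gen false) : S true ⊔ S false ≤ T) ha w hw

theorem mul_mem_altSpanLeft {a w : A} (ha : a ∈ S true ⊔ S false)
    (hw : w ∈ altSpanLeft S i) : w * a ∈ altSpanLeft S i := by
  have gen : ∀ k, ∀ a ∈ S k, ∀ w ∈ altSpanLeft S i, w * a ∈ altSpanLeft S i := by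
    intro k a ha w hw
    induction hw using Submodule.span_induction with
    | mem w hw =>
      obtain ⟨j, l, hl, rfl⟩ := hw
      obtain ⟨j', l', hl', e⟩ := hl.exists_mul_right ha
      exact Submodule.subset_span ⟨j', l', hl', e⟩
    | zero => simp
    | add x y _ _ hx hy => rw [add_mul]; exact add_mem hx hy
    | smul c x _ hx => rw [smul_mul_assoc]; exact Submodule.smul_mem _ c hx
  let T : NonUnitalSubalgebra ℂ A :=
    { carrier := {a | ∀ w ∈ altSpanLeft S i, w * a ∈ altSpanLeft S i}
      add_mem' := fun ha hb w hw => by rw [mul_add]; exact add_mem (ha w hw) (hb w hw)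
      zero_mem' := fun w _ => by simp
      mul_mem' := fun ha hb w hw => by rw [← mul_assoc]; exact hb _ (ha w hw)
      smul_mem' := fun c a ha w hw => by
        rw [mul_smul_comm]; exact Submodule.smul_mem _ c (ha w hw) }
  exact (sup_le (gen true) (gen false) : S true ⊔ S false ≤ T) ha w hw

theorem prod_mul_mem_altSpanRight {u : List A} (hu : ∀ a ∈ u, a ∈ S true ⊔ S false) {w : A}
    (hw : w ∈ altSpanRight S j) : u.prod * w ∈ altSpanRight S j := by
  induction u with
  | nil => simpa
  | cons a u ih =>
    rw [List.forall_mem_cons] at hu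
    rw [List.prod_cons, mul_assoc]
    exact mul_mem_altSpanRight hu.1 (ih hu.2)

theorem mul_prod_mem_altSpanLeft {v : List A} (hv : ∀ a ∈ v, a ∈ S true ⊔ S false) {w : A}
    (hw : w ∈ altSpanLeft S i) : w * v.prod ∈ altSpanLeft S i := by
  induction v generalizing w with
  | nil => simpa
  | cons a v ih =>
    rw [List.forall_mem_cons] at hv
    rw [List.prod_cons, ← mul_assoc]
    exact ih hv.2 (mul_mem_altSpanLeft hv.1 hw)

/-- A boolean independent `φ` factorizes at a place where the subalgebra changes. -/
theorem BooleanIndep.map_mul_of_mem_altSpan {φ : A →ₗ[ℂ] C}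
    (hindep : BooleanIndep φ (S true) (S false)) {p q : A}
    (hp : p ∈ altSpanRight S j) (hq : q ∈ altSpanLeft S (!j)) : φ (p * q) = φ p * φ q := by
  induction hp using Submodule.span_induction with
  | mem p hp =>
    obtain ⟨i, l, hl, rfl⟩ := hp
    induction hq using Submodule.span_induction with
    | mem q hq =>
      obtain ⟨k, m, hm, rfl⟩ := hq
      rw [← List.prod_append, (hl.append hm).map_prod hindep, hl.map_prod hindep,
        hm.map_prod hindep, List.map_append, List.prod_append]
    | zero => simp
    | add x y _ _ hx hy => simp only [mul_add, map_add, hx, hy]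
    | smul c x _ hx => simp only [mul_smul_comm, map_smul, hx]
  | zero => simp
  | add x y _ _ hx hy => simp only [add_mul, map_add, hx, hy]
  | smul c x _ hx => simp only [smul_mul_assoc, map_smul, hx]

theorem BooleanIndep.map_prod_append {φ : A →ₗ[ℂ] C} {A1 A2 : NonUnitalSubalgebra ℂ A}
    (hindep : BooleanIndep φ A1 A2) {X Y : A} (hX : X ∈ A1) (hY : Y ∈ A2) {u v : List A}
    (hu : ∀ a ∈ u, a ∈ A1 ⊔ A2) (hv : ∀ a ∈ v, a ∈ A1 ⊔ A2) :
    φ ((u ++ [X * Y]).prod * ((X * Y) :: v).prod) =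
      φ (u ++ [X * Y]).prod * φ ((X * Y) :: v).prod := by
  obtain ⟨S, rfl, rfl⟩ : ∃ S : Bool → NonUnitalSubalgebra ℂ A, S true = A1 ∧ S false = A2 :=
    ⟨fun i => cond i A1 A2, rfl, rfl⟩
  have hXY : IsAltWord S true false [X, Y] := .cons hX (.single hY)
  have hright : X * Y ∈ altSpanRight S false := Submodule.subset_span ⟨_, _, hXY, by simp⟩
  have hleft : X * Y ∈ altSpanLeft S true := Submodule.subset_span ⟨_, _, hXY, by simp⟩
  rw [List.prod_append, List.prod_singleton, List.prod_cons]
  exact BooleanIndep.map_mul_of_mem_altSpan (S := S) hindep (j := false)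
    (prod_mul_mem_altSpanRight hu hright) (mul_prod_mem_altSpanLeft hv hleft)

end Span

/-- Proposition 3.5 (ii): the boolean cumulant with two consecutive entries equal to
`XY` vanishes: `b^{n+2}(a₁,…,a_k, XY, XY, a_{k+1},…,aₙ) = 0`. -/
theorem boolean_cumulant_XY_XY_vanish
    {A C : Type*} [Ring A] [Algebra ℂ A] [Ring C] [Algebra ℂ C]
    (φ : A →ₗ[ℂ] C) (hφ : φ 1 = 1)
    (A1 A2 : NonUnitalSubalgebra ℂ A) (hindep : BooleanIndep φ A1 A2)
    (b : List A → C) (hb : IsBooleanCumulant φ b)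
    (X Y : A) (hX : X ∈ A1) (hY : Y ∈ A2)
    (u v : List A) (hu : ∀ a ∈ u, a ∈ A1 ⊔ A2) (hv : ∀ a ∈ v, a ∈ A1 ⊔ A2) :
    b (u ++ (X * Y) :: (X * Y) :: v) = 0 := by
  induction hn : v.length using Nat.strong_induction_on generalizing v with
  | _ n ih =>
  subst hn
  set T := X * Y
  have hl : u ++ T :: T :: v = (u ++ [T]) ++ (T :: v) := by simp
  have hrec := hb (u ++ T :: T :: v) (by simp)
  have hlen : (u ++ T :: T :: v).length = (u ++ [T]).length + (v.length + 1) := by simp; omega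
  have hfst : ∑ k ∈ Finset.range (u ++ [T]).length, b ((u ++ T :: T :: v).take (k + 1)) *
      φ ((u ++ T :: T :: v).drop (k + 1)).prod = φ (u ++ [T]).prod * φ (T :: v).prod := by
    rw [hb (u ++ [T]) (by simp), Finset.sum_mul]
    refine Finset.sum_congr rfl fun k hk => ?_
    have hk' : k + 1 ≤ (u ++ [T]).length := Finset.mem_range.1 hk
    rw [hl, List.take_append_of_le_length hk', List.drop_append_of_le_length hk',
      List.prod_append, mul_assoc]
    congr 1
    rw [List.length_append, List.length_singleton, Nat.add_le_add_iff_right] at hk'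
    rcases hk'.eq_or_lt with rfl | hk'
    · rw [List.drop_of_length_le (by simp)]
      simp [hφ]
    · rw [List.drop_append_of_le_length hk']
      exact hindep.map_prod_append hX hY (fun a ha => hu a (List.mem_of_mem_drop ha)) hv
  rw [hlen, Finset.sum_range_add, hfst, hl, List.prod_append,
    hindep.map_prod_append hX hY hu hv, left_eq_add, Finset.sum_range_succ,
    Finset.sum_eq_zero, zero_add] at hrec
  · rwa [← hl, List.take_of_length_le (by simp; omega), List.drop_of_length_le (by simp; omega),
      List.prod_nil, hφ, mul_one] at hrec
  · intro k hk
    rw [Finset.mem_range] at hk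
    have htake : ((u ++ [T]) ++ (T :: v)).take ((u ++ [T]).length + k + 1) =
        u ++ T :: T :: v.take k := by
      rw [add_assoc, List.take_length_add_append]
      simp
    rw [htake, ih _ (by simpa using hk) (v.take k)
      (fun a ha => hv a (List.mem_of_mem_take ha)) (by simp [hk.le]), zero_mul]
end

section
/- Let 𝒜₁ and 𝒜₂ be boolean independent subalgebras of 𝒜 with respect to φ, X ∈ 𝒜₁, Y ∈ 𝒜₂, and a₁, …, aₙ ∈ 𝒜₁ ∨ 𝒜₂ (n ≥ 0). Then for every 0 ≤ k ≤ n the boolean cumulant with consecutive entries Y and XY vanishes: b^{n+2}(a₁, …, a_k, Y, XY, a_{k+1}, …, aₙ) = 0. -/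
/-- `AlternatingWord S i j l`: the letters of the nonempty list `l` lie alternately in `S true`
and `S false`, the first one in `S i` and the last one in `S j`. -/
inductive AlternatingWord {A : Type*} [Ring A] [Algebra ℂ A]
    (S : Bool → NonUnitalSubalgebra ℂ A) : Bool → Bool → List A → Prop
  | single {i : Bool} {a : A} (ha : a ∈ S i) : AlternatingWord S i i [a]
  | cons {i j : Bool} {a : A} {l : List A} (ha : a ∈ S i) (hl : AlternatingWord S (!i) j l) :
      AlternatingWord S i j (a :: l)

namespace AlternatingWord

variable {A C : Type*} [Ring A] [Algebra ℂ A] [Ring C] [Algebra ℂ C]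
  {S : Bool → NonUnitalSubalgebra ℂ A} {i j k : Bool} {l m : List A}

theorem ne_nil (h : AlternatingWord S i j l) : l ≠ [] := by
  cases h <;> simp

theorem append (hl : AlternatingWord S i j l) (hm : AlternatingWord S (!j) k m) :
    AlternatingWord S i k (l ++ m) := by
  induction hl with
  | single ha => exact .cons ha hm
  | cons ha _ ih => exact .cons ha (ih hm)

theorem mem_or_mem (h : AlternatingWord S i j l) : ∀ x ∈ l, x ∈ S true ∨ x ∈ S false := by
  induction h with
  | @single i a ha => cases i <;> simp [ha]
  | @cons i j a l ha _ ih =>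
    intro x hx
    rcases List.mem_cons.1 hx with rfl | hx
    · cases i <;> simp [ha]
    · exact ih x hx

theorem isChain (h : AlternatingWord S i j l) :
    l.IsChain (fun x y => (x ∈ S true ∧ y ∈ S false) ∨ (x ∈ S false ∧ y ∈ S true)) := by
  induction h with
  | single ha => exact List.isChain_singleton _
  | @cons i j a l ha hl ih =>
    cases hl with
    | single hb => cases i <;> simp_all
    | cons hb _ => cases i <;> simp_all

theorem map_prod {φ : A →ₗ[ℂ] C} (hindep : BooleanIndep φ (S true) (S false))
    (h : AlternatingWord S i j l) : φ l.prod = (l.map φ).prod :=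
  hindep l h.ne_nil h.mem_or_mem h.isChain

theorem exists_mul_prod (h : AlternatingWord S i j l) {a : A} (ha : a ∈ S k) :
    ∃ l', AlternatingWord S k j l' ∧ l'.prod = a * l.prod := by
  by_cases hik : i = k
  · subst hik
    cases h with
    | @single _ c hc => exact ⟨[a * c], .single (mul_mem ha hc), by simp⟩
    | @cons _ _ c m hc hm => exact ⟨(a * c) :: m, .cons (mul_mem ha hc) hm, by simp [mul_assoc]⟩
  · obtain rfl : i = !k := by cases i <;> cases k <;> simp_all
    exact ⟨a :: l, .cons ha h, by simp⟩

theorem exists_prod_mul (h : AlternatingWord S i j l) {a : A} (ha : a ∈ S k) :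
    ∃ l', AlternatingWord S i k l' ∧ l'.prod = l.prod * a := by
  induction h with
  | @single i c hc =>
    by_cases hik : i = k
    · subst hik
      exact ⟨[c * a], .single (mul_mem hc ha), by simp⟩
    · obtain rfl : k = !i := by cases i <;> cases k <;> simp_all
      exact ⟨[c, a], .cons hc (.single ha), by simp⟩
  | cons hc _ ih =>
    obtain ⟨l', hl', h'⟩ := ih
    exact ⟨_ :: l', .cons hc hl', by simp [h', mul_assoc]⟩

end AlternatingWord

/-- The linear span of `1` and the products of alternating words. -/
def alternatingSpan {A : Type*} [Ring A] [Algebra ℂ A]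
    (S : Bool → NonUnitalSubalgebra ℂ A) : Submodule ℂ A :=
  Submodule.span ℂ {p | p = 1 ∨ ∃ i j l, AlternatingWord S i j l ∧ l.prod = p}

section

variable {A C : Type*} [Ring A] [Algebra ℂ A] [Ring C] [Algebra ℂ C]
  {S : Bool → NonUnitalSubalgebra ℂ A} {φ : A →ₗ[ℂ] C}

theorem mul_mem_alternatingSpan {i : Bool} {a p : A} (ha : a ∈ S i)
    (hp : p ∈ alternatingSpan S) : a * p ∈ alternatingSpan S := by
  induction hp using Submodule.span_induction with
  | mem p hp =>
    refine Submodule.subset_span (Or.inr ?_)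
    rcases hp with rfl | ⟨j, k, l, hl, rfl⟩
    · exact ⟨i, i, [a], .single ha, by simp⟩
    · exact ⟨i, k, hl.exists_mul_prod ha⟩
  | zero => simp
  | add p q _ _ hp hq => rw [mul_add]; exact add_mem hp hq
  | smul c p _ hp => rw [mul_smul_comm]; exact Submodule.smul_mem _ c hp

theorem sup_mul_mem_alternatingSpan {a : A} (ha : a ∈ S true ⊔ S false) :
    ∀ p ∈ alternatingSpan S, a * p ∈ alternatingSpan S := by
  rw [← NonUnitalAlgebra.adjoin_eq (S true), ← NonUnitalAlgebra.adjoin_eq (S false),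
    ← NonUnitalAlgebra.adjoin_union] at ha
  induction ha using NonUnitalAlgebra.adjoin_induction with
  | mem a ha =>
    intro p hp
    rcases ha with ha | ha <;> exact mul_mem_alternatingSpan ha hp
  | zero => simp
  | add a c _ _ ha hc => intro p hp; rw [add_mul]; exact add_mem (ha p hp) (hc p hp)
  | mul a c _ _ ha hc => intro p hp; rw [mul_assoc]; exact ha _ (hc p hp)
  | smul r a _ ha => intro p hp; rw [smul_mul_assoc]; exact Submodule.smul_mem _ r (ha p hp)

theorem list_prod_mem_alternatingSpan {l : List A} (hl : ∀ a ∈ l, a ∈ S true ⊔ S false) :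
    l.prod ∈ alternatingSpan S := by
  induction l with
  | nil => exact Submodule.subset_span (Or.inl rfl)
  | cons a l ih =>
    rw [List.prod_cons]
    exact sup_mul_mem_alternatingSpan (hl a (by simp)) _ (ih fun c hc => hl c (by simp [hc]))

/-- A boolean independent functional splits at a junction between the two subalgebras. -/
theorem BooleanIndep.map_mul_mul (hindep : BooleanIndep φ (S true) (S false))
    {X Y P Q : A} (hX : X ∈ S true) (hY : Y ∈ S false)
    (hP : P ∈ alternatingSpan S) (hQ : Q ∈ alternatingSpan S) :
    φ ((P * Y) * (X * Q)) = φ (P * Y) * φ (X * Q) := by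
  induction hP using Submodule.span_induction with
  | zero => simp
  | add p q _ _ hp hq => simp only [add_mul, map_add, hp, hq]
  | smul c p _ hp => simp only [smul_mul_assoc, map_smul, hp]
  | mem P hP =>
    obtain ⟨i, l, hl, hlP⟩ : ∃ i l, AlternatingWord S i false l ∧ l.prod = P * Y := by
      rcases hP with rfl | ⟨i, j, l, hl, rfl⟩
      · exact ⟨false, [Y], .single hY, by simp⟩
      · exact ⟨i, hl.exists_prod_mul hY⟩
    induction hQ using Submodule.span_induction with
    | zero => simp
    | add p q _ _ hp hq => simp only [mul_add, map_add, hp, hq]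
    | smul c p _ hp => simp only [mul_smul_comm, map_smul, hp]
    | mem Q hQ =>
      obtain ⟨k, m, hm, hmQ⟩ : ∃ k m, AlternatingWord S true k m ∧ m.prod = X * Q := by
        rcases hQ with rfl | ⟨i, j, m, hm, rfl⟩
        · exact ⟨true, [X], .single hX, by simp⟩
        · exact ⟨j, hm.exists_mul_prod hX⟩
      rw [← hlP, ← hmQ, ← List.prod_append, (hl.append hm).map_prod hindep,
        hl.map_prod hindep, hm.map_prod hindep, List.map_append, List.prod_append]

/-- If `φ` splits between every nonempty suffix of `u` and `w`, then the cumulants whose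
arguments extend beyond `u` contribute zero to `φ (u.prod * w.prod)`. -/
theorem IsBooleanCumulant.sum_append_eq_zero {b : List A → C} (hb : IsBooleanCumulant φ b)
    (hφ : φ 1 = 1) {u w : List A} (hu : u ≠ [])
    (h : ∀ k < u.length, φ ((u.drop k).prod * w.prod) = φ (u.drop k).prod * φ w.prod) :
    ∑ k ∈ Finset.range w.length,
      b (u ++ w.take (k + 1)) * φ ((w.drop (k + 1)).prod) = 0 := by
  have hsum := hb (u ++ w) (by simp [hu])
  have hpos := List.length_pos_iff.2 hu
  have h0 := h 0 hpos
  have hfirst : ∑ k ∈ Finset.range u.length,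
      b ((u ++ w).take (k + 1)) * φ (((u ++ w).drop (k + 1)).prod) = φ u.prod * φ w.prod := by
    rw [hb u hu, Finset.sum_mul]
    refine Finset.sum_congr rfl fun k hk => ?_
    have hk : k + 1 ≤ u.length := Finset.mem_range.1 hk
    rw [List.take_append_of_le_length hk, List.drop_append_of_le_length hk, List.prod_append,
      mul_assoc]
    rcases hk.lt_or_eq with hk | hk
    · rw [h _ hk]
    · simp [hk, hφ]
  rw [List.length_append, Finset.sum_range_add, hfirst, List.prod_append] at hsum
  simp only [List.drop_zero] at h0
  rw [h0, left_eq_add] at hsum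
  rw [← hsum]
  refine Finset.sum_congr rfl fun k _ => ?_
  rw [add_assoc, List.take_length_add_append, List.drop_length_add_append]

end

/-- Proposition 3.5 (iii): the boolean cumulant with consecutive entries `Y` and `XY`
vanishes: `b^{n+2}(a₁,…,a_k, Y, XY, a_{k+1},…,aₙ) = 0`. -/
theorem boolean_cumulant_Y_XY_vanish
    {A C : Type*} [Ring A] [Algebra ℂ A] [Ring C] [Algebra ℂ C]
    (φ : A →ₗ[ℂ] C) (hφ : φ 1 = 1)
    (A1 A2 : NonUnitalSubalgebra ℂ A) (hindep : BooleanIndep φ A1 A2)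
    (b : List A → C) (hb : IsBooleanCumulant φ b)
    (X Y : A) (hX : X ∈ A1) (hY : Y ∈ A2)
    (u v : List A) (hu : ∀ a ∈ u, a ∈ A1 ⊔ A2) (hv : ∀ a ∈ v, a ∈ A1 ⊔ A2) :
    b (u ++ Y :: (X * Y) :: v) = 0 := by
  let S : Bool → NonUnitalSubalgebra ℂ A := fun i => cond i A1 A2
  induction hn : v.length using Nat.strong_induction_on generalizing v with
  | _ n ih =>
    subst hn
    have hsum := hb.sum_append_eq_zero hφ (u := u ++ [Y]) (w := (X * Y) :: v) (by simp) (by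
      intro k hk
      rw [List.length_append, List.length_singleton, Nat.lt_succ_iff] at hk
      rw [List.drop_append_of_le_length hk, List.prod_append, List.prod_singleton,
        List.prod_cons, mul_assoc X]
      refine BooleanIndep.map_mul_mul (S := S) hindep hX hY
        (list_prod_mem_alternatingSpan fun a ha => hu a (List.mem_of_mem_drop ha)) ?_
      exact mul_mem_alternatingSpan (i := false) hY (list_prod_mem_alternatingSpan hv))
    rw [List.length_cons, Finset.sum_range_succ, Finset.sum_eq_zero, zero_add] at hsum
    · simpa [hφ] using hsum
    · intro k hk
      have hk : k < v.length := Finset.mem_range.1 hk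
      have := ih k hk (v.take k) (fun a ha => hv a (List.mem_of_mem_take ha))
        (by simp [hk.le])
      simp [this]
end

section
/- Let 𝒜₁ and 𝒜₂ be boolean independent subalgebras of 𝒜 with respect to φ, X ∈ 𝒜₁ and Y ∈ 𝒜₂. Then for every n ≥ 1: b^n_{X+Y+XY} = b^n_X + b^n_Y + Σ_{k=1}^{n} b^k_X · b^{n−k+1}_Y. -/
open PowerSeries in
/-- Unrolling a two-parameter recursion into a Cauchy product. -/
lemma mk_eq_mk_mul_of_recursion {C : Type*} [Ring C] (u : ℕ → C) (q : C⟦X⟧) (f : ℕ → ℕ → C)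
    (h0 : ∀ a, f a 0 = u a * coeff 0 q)
    (hs : ∀ a k, f a (k + 1) = u a * coeff (k + 1) q + f (a + 1) k) :
    PowerSeries.mk (f 0) = PowerSeries.mk u * q := by
  have key : ∀ k a, f a k = ∑ p ∈ Finset.HasAntidiagonal.antidiagonal k, u (a + p.1) * coeff p.2 q := by
    intro k
    induction k with
    | zero => intro a; simpa using h0 a
    | succ k ih =>
      intro a
      rw [hs, ih, Finset.Nat.sum_antidiagonal_succ]
      simp only [add_zero, add_assoc, add_comm 1]
  ext k
  simp [coeff_mul, key k 0]

open PowerSeries in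
/-- A power series with constant coefficient `1` can be cancelled on the right. -/
lemma PowerSeries.eq_zero_of_mul_eq_zero_of_coeff_zero_eq_one {C : Type*} [Ring C]
    {f m : C⟦X⟧} (hm : coeff 0 m = 1) (h : f * m = 0) : f = 0 := by
  ext n
  induction n using Nat.strong_induction_on with
  | _ n ih =>
    have h1 := congrArg (coeff n) h
    rw [coeff_mul, Finset.sum_eq_single (n, 0)] at h1
    · simpa only [hm, mul_one] using h1
    · rintro ⟨i, j⟩ hij hne
      rw [Finset.HasAntidiagonal.mem_antidiagonal] at hij
      have hi : i < n := by
        rcases Nat.eq_zero_or_pos j with rfl | hj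
        · exact absurd (by simpa using hij) (by simpa using hne)
        · simp only at hij; omega
      simp [ih i hi]
    · simp

open PowerSeries in
/-- The moment series with its constant term split off. -/
lemma mk_eq_one_add_X_mul {C : Type*} [Ring C] (s : ℕ → C) (h : s 0 = 1) :
    PowerSeries.mk s = 1 + X * PowerSeries.mk fun n => s (n + 1) := by
  ext n
  cases n <;> simp [h, coeff_succ_X_mul, coeff_one]

section BooleanWords

variable {A C : Type*} [Ring A] [Algebra ℂ A] [Ring C] [Algebra ℂ C]

lemma IsBooleanCumulant.mk_replicate {φ : A →ₗ[ℂ] C} {b : List A → C}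
    (hb : IsBooleanCumulant φ b) (U : A) :
    (PowerSeries.mk fun n => φ (U ^ (n + 1))) =
      (PowerSeries.mk fun n => b (List.replicate (n + 1) U)) *
        PowerSeries.mk fun n => φ (U ^ n) := by
  ext n
  have h := hb (List.replicate (n + 1) U) (by simp)
  simp only [PowerSeries.coeff_mul, PowerSeries.coeff_mk]
  rw [Finset.Nat.sum_antidiagonal_eq_sum_range_succ_mk]
  simp only [List.prod_replicate, List.length_replicate] at h
  rw [h]
  refine Finset.sum_congr rfl fun k hk => ?_
  have hk' : k ≤ n := by simpa [Nat.lt_succ_iff] using hk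
  simp [List.take_replicate, List.drop_replicate, hk']

lemma BooleanIndep.symm {φ : A →ₗ[ℂ] C} {P Q : NonUnitalSubalgebra ℂ A}
    (h : BooleanIndep φ P Q) : BooleanIndep φ Q P := fun l hl hm hc =>
  h l hl (fun x hx => (hm x hx).symm) (List.IsChain.imp (fun _ _ hxy => hxy.symm) hc)

/-- Words whose letters lie alternately in `P` and `Q`, the first one in `P`. -/
inductive AltWord : NonUnitalSubalgebra ℂ A → NonUnitalSubalgebra ℂ A → List A → Prop
  | single {P Q : NonUnitalSubalgebra ℂ A} {a : A} (ha : a ∈ P) : AltWord P Q [a]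
  | cons {P Q : NonUnitalSubalgebra ℂ A} {a : A} {l : List A} (ha : a ∈ P)
      (hl : AltWord Q P l) : AltWord P Q (a :: l)

lemma AltWord.ne_nil {P Q : NonUnitalSubalgebra ℂ A} {l : List A} (h : AltWord P Q l) :
    l ≠ [] := by
  cases h <;> simp

lemma AltWord.head_mem {P Q : NonUnitalSubalgebra ℂ A} {l : List A} (h : AltWord P Q l) :
    ∀ y ∈ l.head?, y ∈ P := by
  cases h <;> simpa

lemma AltWord.mem_or_mem {P Q : NonUnitalSubalgebra ℂ A} {l : List A} (h : AltWord P Q l) :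
    ∀ x ∈ l, x ∈ P ∨ x ∈ Q := by
  induction h with
  | single ha => simp [ha]
  | cons ha _ ih =>
    intro x hx
    rcases List.mem_cons.1 hx with rfl | hx
    · exact Or.inl ha
    · exact (ih x hx).symm

lemma AltWord.isChain {P Q : NonUnitalSubalgebra ℂ A} {l : List A} (h : AltWord P Q l) :
    l.IsChain (fun x y => (x ∈ P ∧ y ∈ Q) ∨ (x ∈ Q ∧ y ∈ P)) := by
  induction h with
  | single ha => simp
  | cons ha hl ih =>
    exact List.isChain_cons.2
      ⟨fun y hy => Or.inl ⟨ha, hl.head_mem y hy⟩, ih.imp fun _ _ hxy => hxy.symm⟩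

lemma BooleanIndep.map_prod {φ : A →ₗ[ℂ] C} {P Q : NonUnitalSubalgebra ℂ A}
    (h : BooleanIndep φ P Q) {l : List A} (hl : AltWord P Q l) :
    φ l.prod = (l.map φ).prod :=
  h l hl.ne_nil hl.mem_or_mem hl.isChain

/-- The span of the products of alternating words starting in `P`. -/
def altSpan (P Q : NonUnitalSubalgebra ℂ A) : Submodule ℂ A :=
  Submodule.span ℂ (List.prod '' {l | AltWord P Q l})

lemma mem_altSpan {P Q : NonUnitalSubalgebra ℂ A} {a : A} (ha : a ∈ P) : a ∈ altSpan P Q :=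
  Submodule.subset_span ⟨[a], .single ha, by simp⟩

lemma mul_mem_altSpan_of_swap {P Q : NonUnitalSubalgebra ℂ A} {a v : A} (ha : a ∈ P)
    (hv : v ∈ altSpan Q P) : a * v ∈ altSpan P Q := by
  induction hv using Submodule.span_induction with
  | mem v hv =>
    obtain ⟨l, hl, rfl⟩ := hv
    exact Submodule.subset_span ⟨a :: l, .cons ha hl, by simp⟩
  | zero => simp
  | add v w _ _ hv hw => rw [mul_add]; exact add_mem hv hw
  | smul c v _ hv => rw [mul_smul_comm]; exact Submodule.smul_mem _ c hv

lemma mul_mem_altSpan {P Q : NonUnitalSubalgebra ℂ A} {a v : A} (ha : a ∈ P)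
    (hv : v ∈ altSpan P Q) : a * v ∈ altSpan P Q := by
  induction hv using Submodule.span_induction with
  | mem v hv =>
    obtain ⟨l, hl, rfl⟩ := hv
    cases hl with
    | single hc => simpa using mem_altSpan (mul_mem ha hc)
    | @cons _ _ c l hc hl =>
      exact Submodule.subset_span ⟨(a * c) :: l, .cons (mul_mem ha hc) hl, by simp [mul_assoc]⟩
  | zero => simp
  | add v w _ _ hv hw => rw [mul_add]; exact add_mem hv hw
  | smul c v _ hv => rw [mul_smul_comm]; exact Submodule.smul_mem _ c hv

lemma BooleanIndep.map_mul_s10 {φ : A →ₗ[ℂ] C} {P Q : NonUnitalSubalgebra ℂ A}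
    (h : BooleanIndep φ P Q) {a v : A} (ha : a ∈ P) (hv : v ∈ altSpan Q P) :
    φ (a * v) = φ a * φ v := by
  induction hv using Submodule.span_induction with
  | mem v hv =>
    obtain ⟨l, hl, rfl⟩ := hv
    rw [← List.prod_cons, h.map_prod (.cons ha hl), h.symm.map_prod hl, List.map_cons,
      List.prod_cons]
  | zero => simp
  | add v w _ _ hv hw => rw [mul_add, map_add, map_add, mul_add, hv, hw]
  | smul c v _ hv => rw [mul_smul_comm, map_smul, map_smul, mul_smul_comm, hv]

lemma NonUnitalSubalgebra.pow_succ_mem {P : NonUnitalSubalgebra ℂ A} {a : A} (ha : a ∈ P)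
    (n : ℕ) : a ^ (n + 1) ∈ P := by
  induction n with
  | zero => simpa
  | succ n ih => rw [pow_succ]; exact mul_mem ih ha

lemma mul_pow_mem_altSpan {P Q : NonUnitalSubalgebra ℂ A} {X Y : A} (hX : X ∈ P) (hY : Y ∈ Q)
    (k : ℕ) :
    X * (X + Y + X * Y) ^ k ∈ altSpan P Q ∧ Y * (X + Y + X * Y) ^ k ∈ altSpan Q P := by
  induction k with
  | zero => simpa using ⟨mem_altSpan hX, mem_altSpan hY⟩
  | succ k ih =>
    obtain ⟨h1, h2⟩ := ih
    have h3 := mul_mem_altSpan_of_swap hX h2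
    simp only [pow_succ', add_mul, mul_add, mul_assoc X Y]
    exact ⟨add_mem (add_mem (mul_mem_altSpan hX h1) h3) (mul_mem_altSpan hX h3),
      add_mem (add_mem (mul_mem_altSpan_of_swap hY h1) (mul_mem_altSpan hY h2))
        (mul_mem_altSpan_of_swap hY h3)⟩

open PowerSeries in
/-- The boolean cumulant series of `X + Y + XY`, shifted by one degree,
is multiplicative after adding `1`. -/
lemma BooleanIndep.mk_cumulant {φ : A →ₗ[ℂ] C} (hφ : φ 1 = 1)
    {P Q : NonUnitalSubalgebra ℂ A} (h : BooleanIndep φ P Q)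
    {b : List A → C} (hb : IsBooleanCumulant φ b) {X Y : A} (hX : X ∈ P) (hY : Y ∈ Q) :
    (PowerSeries.mk fun n => b (List.replicate (n + 1) (X + Y + X * Y))) =
      (PowerSeries.mk fun n => b (List.replicate (n + 1) X)) +
      (PowerSeries.mk fun n => b (List.replicate (n + 1) Y)) +
      (PowerSeries.mk fun n => b (List.replicate (n + 1) X)) *
        (PowerSeries.mk fun n => b (List.replicate (n + 1) Y)) := by
  have hmem := mul_pow_mem_altSpan hX hY
  have eX := hb.mk_replicate X
  have eY := hb.mk_replicate Y
  have eZ := hb.mk_replicate (X + Y + X * Y)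
  have mX := mk_eq_one_add_X_mul (fun n => φ (X ^ n)) (by simpa)
  have mY := mk_eq_one_add_X_mul (fun n => φ (Y ^ n)) (by simpa)
  have mZ := mk_eq_one_add_X_mul (fun n => φ ((X + Y + X * Y) ^ n)) (by simpa)
  have hM : coeff 0 (PowerSeries.mk fun n => φ ((X + Y + X * Y) ^ n)) = 1 := by simpa
  have eG := mk_eq_mk_mul_of_recursion (fun a => φ (Y ^ (a + 1)))
    ((PowerSeries.mk fun n => φ ((X + Y + X * Y) ^ n)) -
      PowerSeries.X * PowerSeries.mk fun n => φ (Y * (X + Y + X * Y) ^ n))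
    (fun a k => φ (Y ^ (a + 1) * (X + Y + X * Y) ^ k))
    (by intro a; simp [hφ])
    (by
      intro a k
      have hv : X * (X + Y + X * Y) ^ k + X * (Y * (X + Y + X * Y) ^ k) ∈ altSpan P Q :=
        add_mem (hmem k).1 (mul_mem_altSpan_of_swap hX (hmem k).2)
      have e := h.symm.map_mul_s10 (NonUnitalSubalgebra.pow_succ_mem hY a) hv
      have e1 : (X + Y + X * Y) ^ (k + 1) =
          (X * (X + Y + X * Y) ^ k + X * (Y * (X + Y + X * Y) ^ k)) +
            Y * (X + Y + X * Y) ^ k := by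
        rw [pow_succ']; noncomm_ring
      simp only [map_sub, coeff_succ_X_mul, coeff_mk]
      rw [e1, mul_add, map_add, map_add, add_sub_cancel_right, e,
        pow_succ Y (a + 1), mul_assoc (Y ^ (a + 1)) Y])
  have eF := mk_eq_mk_mul_of_recursion (fun a => φ (X ^ (a + 1)))
    (1 + (PowerSeries.X * PowerSeries.mk fun n => φ (Y * (X + Y + X * Y) ^ n)) +
      PowerSeries.mk fun n => φ (Y * (X + Y + X * Y) ^ n))
    (fun a k => φ (X ^ (a + 1) * (X + Y + X * Y) ^ k) +
      φ (X ^ (a + 1)) * φ (Y * (X + Y + X * Y) ^ k))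
    (by intro a; simp [mul_add])
    (by
      intro a k
      have e := h.map_mul_s10 (NonUnitalSubalgebra.pow_succ_mem hX a) (hmem k).2
      have e' := h.map_mul_s10 (NonUnitalSubalgebra.pow_succ_mem hX (a + 1)) (hmem k).2
      have e1 : X ^ (a + 1) * (X + Y + X * Y) ^ (k + 1) =
          X ^ (a + 1 + 1) * (X + Y + X * Y) ^ k + X ^ (a + 1) * (Y * (X + Y + X * Y) ^ k) +
            X ^ (a + 1 + 1) * (Y * (X + Y + X * Y) ^ k) := by
        rw [pow_succ' _ k, pow_succ X (a + 1)]
        simp only [mul_add, add_mul, mul_assoc]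
      simp only [map_add, coeff_succ_X_mul, coeff_mk, coeff_one]
      rw [e1, map_add, map_add, e, e']
      simp only [Nat.succ_ne_zero, if_false, zero_add, mul_add]
      abel)
  have eS : (PowerSeries.mk fun n => φ ((X + Y + X * Y) ^ (n + 1))) =
      (PowerSeries.mk fun k => φ (X ^ (0 + 1) * (X + Y + X * Y) ^ k) +
        φ (X ^ (0 + 1)) * φ (Y * (X + Y + X * Y) ^ k)) +
      PowerSeries.mk fun n => φ (Y * (X + Y + X * Y) ^ n) := by
    ext k
    simp only [map_add, coeff_mk, zero_add, pow_one]
    rw [← h.map_mul_s10 hX (hmem k).2, pow_succ', add_mul, add_mul, map_add, map_add, mul_assoc]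
    abel
  simp only [zero_add, pow_one] at eG eF eS
  generalize (PowerSeries.mk fun n => b (List.replicate (n + 1) (X + Y + X * Y))) = cZ at *
  generalize (PowerSeries.mk fun n => b (List.replicate (n + 1) X)) = cX at *
  generalize (PowerSeries.mk fun n => b (List.replicate (n + 1) Y)) = cY at *
  generalize (PowerSeries.mk fun n => φ ((X + Y + X * Y) ^ (n + 1))) = dz at *
  generalize (PowerSeries.mk fun n => φ (X ^ (n + 1))) = dx at *
  generalize (PowerSeries.mk fun n => φ (Y ^ (n + 1))) = dy at *
  generalize (PowerSeries.mk fun n => φ ((X + Y + X * Y) ^ n)) = m at *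
  generalize (PowerSeries.mk fun n => φ (X ^ n)) = mx at *
  generalize (PowerSeries.mk fun n => φ (Y ^ n)) = my at *
  generalize (PowerSeries.mk fun n => φ (Y * (X + Y + X * Y) ^ n)) = g at *
  generalize (PowerSeries.mk fun k => φ (X * (X + Y + X * Y) ^ k) +
    φ X * φ (Y * (X + Y + X * Y) ^ k)) = f at *
  have hg : g = cY * m := by
    have : my * (m - PowerSeries.X * g) = m := by
      rw [mY, add_mul, mul_assoc, ← eG]; noncomm_ring
    rw [eG, eY, mul_assoc, this]
  have hf : f = cX * (m + g) := by
    have : mx * (1 + PowerSeries.X * g + g) = m + g := by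
      rw [mX, add_mul, mul_assoc, ← eF, mZ, eS]; noncomm_ring
    rw [eF, eX, mul_assoc, this]
  rw [← sub_eq_zero]
  apply PowerSeries.eq_zero_of_mul_eq_zero_of_coeff_zero_eq_one hM
  rw [sub_mul, ← eZ, eS, hf, hg]
  noncomm_ring

end BooleanWords


/-- Corollary 3.6: for boolean independent `X ∈ A1`, `Y ∈ A2` and `n ≥ 1`,
`b^n_{X+Y+XY} = b^n_X + b^n_Y + ∑_{k=1}^{n} b^k_X ⬝ b^{n-k+1}_Y`. -/
theorem boolean_cumulant_X_plus_Y_plus_XY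
    {A C : Type*} [Ring A] [Algebra ℂ A] [Ring C] [Algebra ℂ C]
    (φ : A →ₗ[ℂ] C) (hφ : φ 1 = 1)
    (A1 A2 : NonUnitalSubalgebra ℂ A) (hindep : BooleanIndep φ A1 A2)
    (b : List A → C) (hb : IsBooleanCumulant φ b)
    (X Y : A) (hX : X ∈ A1) (hY : Y ∈ A2)
    (n : ℕ) (hn : 1 ≤ n) :
    b (List.replicate n (X + Y + X * Y)) =
      b (List.replicate n X) + b (List.replicate n Y) +
        ∑ k ∈ Finset.Icc 1 n,
          b (List.replicate k X) * b (List.replicate (n - k + 1) Y) := by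
  obtain ⟨n, rfl⟩ : ∃ m, n = m + 1 := ⟨n - 1, by omega⟩
  have key := congrArg (PowerSeries.coeff n) (hindep.mk_cumulant hφ hb hX hY)
  simp only [map_add, PowerSeries.coeff_mul, PowerSeries.coeff_mk] at key
  rw [key, Finset.Nat.sum_antidiagonal_eq_sum_range_succ_mk, Finset.range_eq_Ico,
    ← Finset.Ico_add_one_right_eq_Icc, ← Finset.sum_Ico_add' _ 0 (n + 1) 1]
  simp only [Nat.add_sub_add_right]
end

section
/- Let 𝒜₁ and 𝒜₂ be boolean independent subalgebras of 𝒜 with respect to φ, X ∈ 𝒜₁ and Y ∈ 𝒜₂. Then the boolean cumulant generating series satisfy the multiplicative property B_{(1+X)(1+Y)}(z) = B_{(1+X)}(z) · B_{(1+Y)}(z) as formal power series; equivalently, for every n ≥ 1: b^n_{(1+X)(1+Y)} = Σ_{k=1}^{n} b^k_{(1+X)} · b^{n−k+1}_{(1+Y)}. -/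
section Resolvent

variable {R : Type*} [Ring R]

/-- If `P`, `Q`, `S` are one-sided inverses of `1 - z(1+s)`, `1 - z(1+t)` and
`1 - z(1+s)(1+t)` with `z` central, then `E = (1 - z(1+t)) S` satisfies
`E = 1 + z P s + z P s t S`. -/
theorem resolvent_mul_expansion {z s t P S : R} (hz : ∀ a, a * z = z * a)
    (hP : P * (1 - z * (1 + s)) = 1)
    (hS : (1 - z * ((1 + s) * (1 + t))) * S = 1) :
    (1 - z * (1 + t)) * S = 1 + z * (P * s) + z * (P * s * (t * S)) := by
  have hz' : ∀ a b, a * (z * b) = z * (a * b) := fun a b => by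
    rw [← mul_assoc, hz, mul_assoc]
  have h1 : (1 - z * (1 + s)) * (1 - z * (1 + t)) - z * (s * t) =
      (1 - z) * (1 - z * ((1 + s) * (1 + t))) := by
    simp only [mul_add, add_mul, mul_sub, sub_mul, mul_one, one_mul, mul_assoc, hz' s, hz s]
    abel
  have h2 : (1 - z) * P = 1 + z * (P * s) := by
    have : P - z * P - z * (P * s) = 1 := by
      rw [← hP]
      simp only [mul_add, mul_sub, mul_one, hz' P, hz P]
      abel
    rw [sub_mul, one_mul, ← this]
    abel
  have h3 : P * (1 - z) = (1 - z) * P := by rw [mul_sub, sub_mul, hz, mul_one, one_mul]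
  calc (1 - z * (1 + t)) * S
      = P * (1 - z * (1 + s)) * ((1 - z * (1 + t)) * S) := by rw [hP, one_mul]
    _ = P * (((1 - z * (1 + s)) * (1 - z * (1 + t)) - z * (s * t)) * S)
          + P * (z * (s * t) * S) := by
        rw [← mul_add, ← add_mul, sub_add_cancel, mul_assoc, mul_assoc]
    _ = P * (1 - z) + z * (P * s * (t * S)) := by
        rw [h1, mul_assoc (1 - z), hS, mul_one]
        simp only [mul_assoc, hz']
    _ = _ := by rw [h3, h2]

/-- The algebraic relation between the moment series `M` of a product and the cumulant
series `B₁`, `B₂` of its factors. -/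
theorem moment_eq_of_factor_relations {z f g e M B₁ B₂ : R}
    (hz : ∀ a, a * z = z * a) (hz1 : IsUnit (1 - z)) (hf : IsUnit (1 + z * f))
    (he : e = 1 + z * f + z * (f * (g * e)))
    (hM : (1 - z) * M = e + z * (g * e))
    (h₁ : (1 + z * f) * B₁ = 1 + f) (h₂ : B₂ * (1 + z * g) = 1 + g) :
    M = 1 + z * (B₁ * B₂) * M := by
  have hz' : ∀ a b, a * (z * b) = z * (a * b) := fun a b => by
    rw [← mul_assoc, hz, mul_assoc]
  have hc : ∀ a, (1 - z) * a = a * (1 - z) := fun a => by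
    rw [mul_sub, sub_mul, hz, mul_one, one_mul]
  have hM' : (1 - z) * M = (1 + z * g) * e := by rw [hM, add_mul, one_mul, mul_assoc]
  have h4 : (1 - z) * (z * (B₁ * B₂) * M) = z * (B₁ * ((1 + g) * e)) := by
    rw [← mul_assoc, hc, mul_assoc, hM', ← h₂]
    simp only [mul_assoc]
  refine hz1.mul_left_cancel (hf.mul_left_cancel ?_)
  rw [mul_add (1 - z), h4, mul_one, hM', mul_add (1 + z * f), hz' (1 + z * f),
    ← mul_assoc (1 + z * f) B₁, h₁]
  have h5 : (1 + z * f) * (1 - z) = (1 - z) * (e - z * (f * (g * e))) := by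
    rw [← hc]
    congr 1
    nth_rw 1 [he]
    abel
  rw [h5]
  simp only [mul_add, add_mul, mul_sub, sub_mul, one_mul, mul_assoc, hz' f]
  abel

end Resolvent

namespace PowerSeries

/-- Coefficientwise application of an additive map to a power series. -/
noncomputable def mapCoeff {A C : Type*} [Ring A] [Ring C] (φ : A →+ C) :
    PowerSeries A →+ PowerSeries C where
  toFun a := mk fun n => φ (coeff n a)
  map_zero' := by ext; simp
  map_add' _ _ := by ext; simp

section MapCoeff

variable {A C : Type*} [Ring A] [Ring C] (φ : A →+ C)

@[simp]
theorem coeff_mapCoeff (n : ℕ) (a : PowerSeries A) :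
    coeff n (mapCoeff φ a) = φ (coeff n a) := by
  simp [mapCoeff]

theorem mapCoeff_X_mul (a : PowerSeries A) : mapCoeff φ (X * a) = X * mapCoeff φ a := by
  ext n
  cases n <;> simp [coeff_succ_X_mul]

theorem mapCoeff_one (h : φ 1 = 1) : mapCoeff φ 1 = 1 := by
  ext n
  by_cases hn : n = 0 <;> simp [coeff_one, hn, h]

theorem mapCoeff_mul {a c : PowerSeries A}
    (h : ∀ m n, φ (coeff m a * coeff n c) = φ (coeff m a) * φ (coeff n c)) :
    mapCoeff φ (a * c) = mapCoeff φ a * mapCoeff φ c := by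
  ext n
  simp [coeff_mul, h]

end MapCoeff

section Geometric

variable {A : Type*} [Ring A]

theorem one_sub_X_mul_C_mul_mk_pow (a : A) :
    (1 - X * C a) * mk (fun n => a ^ n) = 1 := by
  ext n
  cases n <;> simp [sub_mul, mul_assoc, coeff_succ_X_mul, pow_succ', coeff_one]

theorem mk_pow_mul_one_sub_X_mul_C (a : A) :
    mk (fun n => a ^ n) * (1 - X * C a) = 1 := by
  rw [X_mul]
  ext n
  cases n <;> simp [mul_sub, ← mul_assoc, coeff_succ_mul_X, pow_succ, coeff_one]

theorem commute_C_mk_pow {a c : A} (h : Commute c a) :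
    Commute (C c) (mk fun n => a ^ n) := by
  ext n
  simpa using (h.pow_right n).eq

theorem isUnit_one_add_X_mul (a : PowerSeries A) : IsUnit (1 + X * a) :=
  isUnit_iff_constantCoeff.2 (by simp)

theorem X_mul_left_cancel {a c : PowerSeries A} (h : X * a = X * c) : a = c := by
  ext n
  simpa [coeff_succ_X_mul] using congrArg (coeff (n + 1)) h

/-- The series `B` of boolean cumulants is determined by the moment series `M`. -/
theorem eq_of_eq_one_add_X_mul_mul {M B B' : PowerSeries A}
    (h : M = 1 + X * B * M) (h' : M = 1 + X * B' * M) : B = B' := by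
  have hM : IsUnit M := by
    rw [h, mul_assoc]
    exact isUnit_one_add_X_mul _
  apply X_mul_left_cancel
  apply hM.mul_right_cancel
  exact add_left_cancel (h.symm.trans h')

/-- If `(1 - z) M = 1 + z f`, the cumulant series of the moment series `M` is the quotient of
`1 + f` by `1 + z f`, on either side. -/
theorem cumulant_relations {M B f : PowerSeries A} (h : M = 1 + X * B * M)
    (hf : (1 - X) * M = 1 + X * f) :
    B * (1 + X * f) = 1 + f ∧ (1 + X * f) * B = 1 + f := by
  have hc : ∀ a : PowerSeries A, (1 - X) * a = a * (1 - X) := fun a => by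
    rw [mul_sub, sub_mul, X_mul, mul_one, one_mul]
  have h1 : B * (1 + X * f) = 1 + f := by
    apply X_mul_left_cancel
    have h2 : (1 - X) * M = (1 - X) + X * (B * ((1 - X) * M)) := by
      conv_lhs => rw [h, mul_add, mul_one, ← mul_assoc, hc, mul_assoc, mul_assoc]
    rw [hf] at h2
    rw [← sub_eq_iff_eq_add'.2 h2, mul_add, mul_one]
    abel
  refine ⟨h1, (isUnit_one_add_X_mul f).mul_right_cancel ?_⟩
  rw [mul_assoc, h1]
  simp only [mul_add, add_mul, mul_one, one_mul, mul_assoc]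
  rw [← mul_assoc f X, ← X_mul (φ := f), mul_assoc]
  abel

end Geometric

/-- Multiplicativity of boolean cumulant series, for a functional that factorizes at every
change between the letters `s` and `t`. -/
theorem cumulant_mul_of_factorization {A C' : Type*} [Ring A] [Ring C'] (φ : A →+ C')
    (hφ : φ 1 = 1) (s t : A)
    (hst : ∀ a c, φ (a * s * (t * c)) = φ (a * s) * φ (t * c))
    (hts : ∀ a c, φ (a * t * (s * c)) = φ (a * t) * φ (s * c))
    {B B₁ B₂ : PowerSeries C'}
    (hB : mk (fun n => φ (((1 + s) * (1 + t)) ^ n)) =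
      1 + X * B * mk (fun n => φ (((1 + s) * (1 + t)) ^ n)))
    (hB₁ : mk (fun n => φ ((1 + s) ^ n)) = 1 + X * B₁ * mk (fun n => φ ((1 + s) ^ n)))
    (hB₂ : mk (fun n => φ ((1 + t) ^ n)) = 1 + X * B₂ * mk (fun n => φ ((1 + t) ^ n))) :
    B = B₁ * B₂ := by
  set P : PowerSeries A := mk fun n => (1 + s) ^ n with hPdef
  set Q : PowerSeries A := mk fun n => (1 + t) ^ n with hQdef
  set S : PowerSeries A := mk fun n => ((1 + s) * (1 + t)) ^ n with hSdef
  have hmk : ∀ u : ℕ → A, mk (fun n => φ (u n)) = mapCoeff φ (mk u) := fun u => by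
    ext; simp
  rw [hmk] at hB hB₁ hB₂
  rw [← hSdef] at hB
  rw [← hPdef] at hB₁
  rw [← hQdef] at hB₂
  have hz : ∀ a : PowerSeries A, a * X = X * a := fun a => (X_mul).symm
  have hzC : ∀ a : PowerSeries C', a * X = X * a := fun a => (X_mul).symm
  have hP := mk_pow_mul_one_sub_X_mul_C (1 + s)
  have hQ := mk_pow_mul_one_sub_X_mul_C (1 + t)
  have hS := one_sub_X_mul_C_mul_mk_pow ((1 + s) * (1 + t))
  rw [← hPdef, map_add, map_one] at hP
  rw [← hQdef, map_add, map_one] at hQ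
  rw [← hSdef, map_mul, map_add, map_add, map_one] at hS
  have hcP : C s * P = P * C s := commute_C_mk_pow (by simp [Commute.add_right])
  have hcQ : C t * Q = Q * C t := commute_C_mk_pow (by simp [Commute.add_right])
  have hΦst : ∀ a c, mapCoeff φ (a * C s * (C t * c)) =
      mapCoeff φ (a * C s) * mapCoeff φ (C t * c) := fun a c =>
    mapCoeff_mul φ fun m n => by simpa using hst _ _
  have hΦts : ∀ a c, mapCoeff φ (a * C t * (C s * c)) =
      mapCoeff φ (a * C t) * mapCoeff φ (C s * c) := fun a c =>
    mapCoeff_mul φ fun m n => by simpa using hts _ _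
  have one_sub_mul : ∀ {u F : PowerSeries A}, F * (1 - X * (1 + u)) = 1 →
      (1 - X) * F = 1 + X * (F * u) := by
    intro u F hF
    have : F - X * F - X * (F * u) = 1 := by
      rw [← hF, mul_sub, mul_one, ← mul_assoc F X, hz, mul_assoc, mul_add, mul_one, mul_add]
      abel
    rw [sub_mul, one_mul, ← this]
    abel
  have map_one_sub_mul : ∀ a : PowerSeries A,
      mapCoeff φ ((1 - X) * a) = (1 - X) * mapCoeff φ a := fun a => by
    rw [sub_mul, sub_mul, map_sub, mapCoeff_X_mul, one_mul, one_mul]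
  set E := (1 - X * (1 + C t)) * S with hEdef
  have hQE : Q * E = S := by rw [hEdef, ← mul_assoc, hQ, one_mul]
  have hE : E = 1 + X * (P * C s) + X * (P * C s * (C t * S)) :=
    resolvent_mul_expansion hz hP hS
  set f := mapCoeff φ (P * C s) with hfdef
  set g := mapCoeff φ (Q * C t) with hgdef
  set e := mapCoeff φ E with hedef
  have hfU : (1 - X) * mapCoeff φ P = 1 + X * f := by
    rw [← map_one_sub_mul, one_sub_mul hP, map_add, mapCoeff_one φ hφ, mapCoeff_X_mul]
  have hgV : (1 - X) * mapCoeff φ Q = 1 + X * g := by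
    rw [← map_one_sub_mul, one_sub_mul hQ, map_add, mapCoeff_one φ hφ, mapCoeff_X_mul]
  have he₀ : e = 1 + X * f + X * (f * mapCoeff φ (C t * S)) := by
    rw [hedef, hE, map_add, map_add, mapCoeff_one φ hφ, mapCoeff_X_mul, mapCoeff_X_mul, hΦst]
  have hyE : C t * S = Q * C t * E := by rw [← hcQ, mul_assoc, hQE]
  have hge : mapCoeff φ (C t * S) = g * e := by
    have h1 : C t * S = Q * C t + X * (Q * C t * (C s * P)) +
        X * (Q * C t * (C s * (P * (C t * S)))) := by
      nth_rw 1 [hyE]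
      rw [hE, mul_add, mul_add, mul_one, ← mul_assoc _ X, ← mul_assoc _ X, hz, mul_assoc X,
        mul_assoc X, ← hcP, mul_assoc (C s)]
    rw [h1, map_add, map_add, mapCoeff_X_mul, mapCoeff_X_mul, hΦts, hΦts,
      ← mul_assoc (C s), hcP, hΦst, he₀, mul_add, mul_add, mul_one,
      ← mul_assoc g X, ← mul_assoc g X, hzC, mul_assoc X, mul_assoc X]
  rw [hge] at he₀
  have hM : (1 - X) * mapCoeff φ S = e + X * (g * e) := by
    rw [← map_one_sub_mul, ← hQE, ← mul_assoc, one_sub_mul hQ, add_mul, one_mul, mul_assoc X,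
      ← hyE, map_add, mapCoeff_X_mul, hge]
  refine eq_of_eq_one_add_X_mul_mul hB (moment_eq_of_factor_relations hzC ?_
    (isUnit_one_add_X_mul f) he₀ hM (cumulant_relations hB₁ hfU).2
    (cumulant_relations hB₂ hgV).1)
  simpa [sub_eq_add_neg] using isUnit_one_add_X_mul (-1 : PowerSeries C')

end PowerSeries

section BooleanIndep

variable {A C : Type*} [Ring A] [Algebra ℂ A] [Ring C] [Algebra ℂ C]

/-- `AlternatingFrom W i l` says that the letters of `l` lie alternately in `W i`, `W !i`, … -/
def AlternatingFrom (W : Bool → NonUnitalSubalgebra ℂ A) : Bool → List A → Prop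
  | _, [] => True
  | i, x :: l => x ∈ W i ∧ AlternatingFrom W (!i) l

/-- A nonempty word in two letters, read as a product of maximal blocks. -/
theorem exists_alternatingFrom (W : Bool → NonUnitalSubalgebra ℂ A) (v : Bool → A)
    (hv : ∀ i, v i ∈ W i) (w : List Bool) (i : Bool) :
    ∃ L : List A, L ≠ [] ∧ L.prod = ((i :: w).map v).prod ∧
      ∀ T, AlternatingFrom W (!(i :: w).getLast (List.cons_ne_nil i w)) T →
        AlternatingFrom W i (L ++ T) := by
  induction w generalizing i with
  | nil => exact ⟨[v i], by simp, by simp, fun T hT => ⟨hv i, hT⟩⟩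
  | cons j w ih =>
    obtain ⟨L, hL, hprod, hT⟩ := ih j
    by_cases hij : j = i
    · subst hij
      obtain ⟨x, L, rfl⟩ := List.exists_cons_of_ne_nil hL
      refine ⟨(v j * x) :: L, by simp, ?_, fun T h => ?_⟩
      · rw [List.prod_cons, mul_assoc, ← List.prod_cons, hprod, List.map_cons (l := j :: w),
          List.prod_cons]
      · have := hT T (by simpa using h)
        exact ⟨mul_mem (hv j) this.1, this.2⟩
    · refine ⟨v i :: L, by simp, by simp [hprod], fun T h => ⟨hv i, ?_⟩⟩
      have hji : (!i) = j := by cases i <;> cases j <;> simp_all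
      rw [hji]
      exact hT T (by simpa using h)

theorem BooleanIndep.map_prod_of_alternatingFrom {φ : A →ₗ[ℂ] C} (hφ : φ 1 = 1)
    {W : Bool → NonUnitalSubalgebra ℂ A} (h : BooleanIndep φ (W true) (W false))
    (i : Bool) (l : List A) (hl : AlternatingFrom W i l) : φ l.prod = (l.map φ).prod := by
  by_cases hnil : l = []
  · simp [hnil, hφ]
  refine h l hnil ?_ ?_
  · clear hnil
    induction l generalizing i with
    | nil => simp
    | cons x l ih =>
      intro y hy
      rcases List.mem_cons.1 hy with rfl | hy
      · cases i
        exacts [Or.inr hl.1, Or.inl hl.1]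
      · exact ih _ hl.2 y hy
  · clear hnil
    induction l generalizing i with
    | nil => exact List.isChain_nil
    | cons x l ih =>
      cases l with
      | nil => exact List.isChain_singleton x
      | cons y l =>
        refine List.isChain_cons_cons.2 ⟨?_, ih _ hl.2⟩
        cases i
        exacts [Or.inr ⟨hl.1, hl.2.1⟩, Or.inl ⟨hl.1, hl.2.1⟩]

/-- The functional factorizes between two consecutive distinct letters of a word. -/
theorem BooleanIndep.map_word_append {φ : A →ₗ[ℂ] C} (hφ : φ 1 = 1)
    {W : Bool → NonUnitalSubalgebra ℂ A} (h : BooleanIndep φ (W true) (W false))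
    {v : Bool → A} (hv : ∀ i, v i ∈ W i) (i : Bool) (w w' : List Bool) :
    φ ((w.map v).prod * v i * (v (!i) * (w'.map v).prod)) =
      φ ((w.map v).prod * v i) * φ (v (!i) * (w'.map v).prod) := by
  obtain ⟨T, -, hTprod, hT⟩ := exists_alternatingFrom W v hv w' (!i)
  replace hT : AlternatingFrom W (!i) T := by simpa using hT [] trivial
  obtain ⟨j, u, hu⟩ := List.exists_cons_of_ne_nil (List.append_ne_nil_of_right_ne_nil w
    (List.cons_ne_nil i []))
  obtain ⟨L, -, hLprod, hL⟩ := exists_alternatingFrom W v hv u j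
  have hlast : (j :: u).getLast (List.cons_ne_nil j u) = i := by simp [← hu]
  rw [hlast] at hL
  have e₁ : (w.map v).prod * v i = L.prod := by rw [hLprod, ← hu]; simp
  have e₂ : v (!i) * (w'.map v).prod = T.prod := by rw [hTprod]; simp
  rw [e₁, e₂, ← List.prod_append, h.map_prod_of_alternatingFrom hφ j _ (hL T hT),
    h.map_prod_of_alternatingFrom hφ _ T hT,
    h.map_prod_of_alternatingFrom hφ j L (by simpa using hL [] trivial), List.map_append,
    List.prod_append]

theorem mem_adjoin_range_induction_words {v : Bool → A} {p : A → Prop}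
    (hword : ∀ w : List Bool, p (w.map v).prod) (hzero : p 0)
    (hadd : ∀ a c, p a → p c → p (a + c)) (hsmul : ∀ (r : ℂ) a, p a → p (r • a))
    {a : A} (ha : a ∈ Algebra.adjoin ℂ (Set.range v)) : p a := by
  rw [← Subalgebra.mem_toSubmodule, Algebra.adjoin_eq_span, ← FreeMonoid.mrange_lift] at ha
  refine Submodule.span_induction ?_ hzero (fun _ _ _ _ => hadd _ _) (fun _ _ _ => hsmul _ _) ha
  rintro _ ⟨w, rfl⟩
  rw [FreeMonoid.lift_apply]
  exact hword _

theorem BooleanIndep.map_mul_of_mem_adjoin {φ : A →ₗ[ℂ] C} (hφ : φ 1 = 1)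
    {W : Bool → NonUnitalSubalgebra ℂ A} (h : BooleanIndep φ (W true) (W false))
    {v : Bool → A} (hv : ∀ i, v i ∈ W i) (i : Bool) {a c : A}
    (ha : a ∈ Algebra.adjoin ℂ (Set.range v)) (hc : c ∈ Algebra.adjoin ℂ (Set.range v)) :
    φ (a * v i * (v (!i) * c)) = φ (a * v i) * φ (v (!i) * c) := by
  refine mem_adjoin_range_induction_words
    (p := fun a => φ (a * v i * (v (!i) * c)) = φ (a * v i) * φ (v (!i) * c))
    (fun w => ?_) (by simp) (fun a a' ha ha' => ?_) (fun r a ha => ?_) ha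
  · refine mem_adjoin_range_induction_words
      (p := fun c => φ ((w.map v).prod * v i * (v (!i) * c)) =
        φ ((w.map v).prod * v i) * φ (v (!i) * c))
      (fun w' => h.map_word_append hφ hv i w w') (by simp)
      (fun c c' hc hc' => ?_) (fun r c hc => ?_) hc
    · simp only [mul_add, map_add, hc, hc']
    · simp only [mul_smul_comm, map_smul, hc]
  · simp only [add_mul, map_add, ha, ha']
  · simp only [smul_mul_assoc, map_smul, ha]

theorem IsBooleanCumulant.moment_series {φ : A →ₗ[ℂ] C} {b : List A → C}
    (hb : IsBooleanCumulant φ b) (hφ : φ 1 = 1) (a : A) :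
    PowerSeries.mk (fun n => φ (a ^ n)) =
      1 + PowerSeries.X * PowerSeries.mk (fun n => b (List.replicate (n + 1) a)) *
        PowerSeries.mk (fun n => φ (a ^ n)) := by
  ext n
  cases n with
  | zero => simp [hφ, mul_assoc]
  | succ n =>
    have h := hb (List.replicate (n + 1) a) (by simp)
    rw [List.prod_replicate, List.length_replicate] at h
    rw [PowerSeries.coeff_mk, h, map_add, mul_assoc, PowerSeries.coeff_succ_X_mul,
      PowerSeries.coeff_mul, Finset.Nat.sum_antidiagonal_eq_sum_range_succ_mk]
    simp only [PowerSeries.coeff_one, PowerSeries.coeff_mk, Nat.succ_ne_zero, if_false, zero_add]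
    refine Finset.sum_congr rfl fun k hk => ?_
    have hk' : k + 1 ≤ n + 1 := Finset.mem_range.1 hk
    rw [List.take_replicate, List.drop_replicate, List.prod_replicate, min_eq_left hk',
      Nat.add_sub_add_right]

end BooleanIndep

/-- Corollary 3.7: the multiplicative property of the boolean cumulant series of
boolean independent `X ∈ A1`, `Y ∈ A2`:
`B_{(1+X)(1+Y)}(z) = B_{(1+X)}(z) ⬝ B_{(1+Y)}(z)` as formal power series (the
coefficient of `z^{n-1}` being `b^n`); equivalently, for every `n ≥ 1`,
`b^n_{(1+X)(1+Y)} = ∑_{k=1}^{n} b^k_{(1+X)} ⬝ b^{n-k+1}_{(1+Y)}`. -/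
theorem boolean_cumulant_multiplicativity
    {A C : Type*} [Ring A] [Algebra ℂ A] [Ring C] [Algebra ℂ C]
    (φ : A →ₗ[ℂ] C) (hφ : φ 1 = 1)
    (A1 A2 : NonUnitalSubalgebra ℂ A) (hindep : BooleanIndep φ A1 A2)
    (b : List A → C) (hb : IsBooleanCumulant φ b)
    (X Y : A) (hX : X ∈ A1) (hY : Y ∈ A2) :
    PowerSeries.mk (fun n => b (List.replicate (n + 1) ((1 + X) * (1 + Y)))) =
      PowerSeries.mk (fun n => b (List.replicate (n + 1) (1 + X))) *
        PowerSeries.mk (fun n => b (List.replicate (n + 1) (1 + Y))) ∧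
    ∀ n : ℕ, 1 ≤ n →
      b (List.replicate n ((1 + X) * (1 + Y))) =
        ∑ k ∈ Finset.Icc 1 n,
          b (List.replicate k (1 + X)) * b (List.replicate (n - k + 1) (1 + Y)) := by
  have hseries : PowerSeries.mk (fun n => b (List.replicate (n + 1) ((1 + X) * (1 + Y)))) =
      PowerSeries.mk (fun n => b (List.replicate (n + 1) (1 + X))) *
        PowerSeries.mk (fun n => b (List.replicate (n + 1) (1 + Y))) := by
    let W : Bool → NonUnitalSubalgebra ℂ A := fun i => cond i A1 A2
    let v : Bool → A := fun i => cond i X Y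
    have hv : ∀ i, v i ∈ W i := fun i => by cases i <;> assumption
    have hW : BooleanIndep φ (W true) (W false) := hindep
    let S := Algebra.adjoin ℂ (Set.range v)
    let s : S := ⟨X, Algebra.subset_adjoin ⟨true, rfl⟩⟩
    let t : S := ⟨Y, Algebra.subset_adjoin ⟨false, rfl⟩⟩
    exact PowerSeries.cumulant_mul_of_factorization (φ.comp S.val.toLinearMap).toAddMonoidHom
      hφ s t
      (fun a c => hW.map_mul_of_mem_adjoin hφ hv true a.2 c.2)
      (fun a c => hW.map_mul_of_mem_adjoin hφ hv false a.2 c.2)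
      (hb.moment_series hφ _) (hb.moment_series hφ _) (hb.moment_series hφ _)
  refine ⟨hseries, fun n hn => ?_⟩
  obtain ⟨m, rfl⟩ := Nat.exists_eq_add_of_le' hn
  have h := congrArg (PowerSeries.coeff m) hseries
  rw [PowerSeries.coeff_mul, Finset.Nat.sum_antidiagonal_eq_sum_range_succ_mk] at h
  simp only [PowerSeries.coeff_mk] at h
  rw [h, ← Finset.Ico_add_one_right_eq_Icc, Finset.sum_Ico_eq_sum_range, Nat.add_sub_cancel]
  refine Finset.sum_congr rfl fun k _ => ?_
  rw [add_comm 1 k, Nat.add_sub_add_right]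
end

section
/- For every n ≥ 2, all X₁, …, Xₙ ∈ 𝔄, every f ∈ 𝔅 and every interior position 1 ≤ k ≤ n−1, inserting f into the lower argument merges the adjacent upper arguments: b̃^{n+1}_{X₁,…,X_k, f, X_{k+1},…,Xₙ}(f₁, …, f_k, f_{k+1}, …, fₙ) = b̃^{n}_{X₁,…,Xₙ}(f₁, …, f_{k−1}, f_k·f·f_{k+1}, f_{k+2}, …, fₙ) for all f₁, …, fₙ ∈ 𝔅. -/
/-- The interleaved word `X₁ f₁ X₂ f₂ ⋯ f_{n-1} Xₙ` built from a list
`Xs = [X₁, …, Xₙ]` (lower arguments) and a list `fs = [f₁, …, f_{n-1}]`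
(upper arguments). -/
def interWord {A : Type*} [Monoid A] : List A → List A → A
  | [], _ => 1
  | [x], _ => x
  | x :: xs, [] => x * interWord xs []
  | x :: xs, f :: fs => x * f * interWord xs fs

/-- `bt` is the family of operator-valued boolean cumulants of the conditional
expectation `Φ : 𝔄 → 𝔅`:  `bt Xs fs` stands for `b̃^n_{X₁,…,Xₙ}(f₁,…,f_{n-1})`
(where `Xs = [X₁,…,Xₙ]`, `fs = [f₁,…,f_{n-1}]`), and for all lower arguments in `𝔄`
and upper arguments in `𝔅`,
`Φ(X₁f₁X₂⋯f_{n-1}Xₙ) = ∑_{k=1}^{n} b̃^k_{X₁,…,X_k}(f₁,…,f_{k-1}) ⬝ f_k ⬝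
Φ(X_{k+1}f_{k+1}⋯f_{n-1}Xₙ)`, the `k = n` summand being
`b̃^n_{X₁,…,Xₙ}(f₁,…,f_{n-1})`. -/
def IsOpBooleanCumulant {A : Type*} [Ring A] [Algebra ℂ A]
    (B : Subalgebra ℂ A) (Φ : A →ₗ[ℂ] A) (bt : List A → List A → A) : Prop :=
  ∀ (Xs fs : List A), Xs.length = fs.length + 1 → (∀ f ∈ fs, f ∈ B) →
    Φ (interWord Xs fs) =
      (∑ k ∈ Finset.range fs.length,
        bt (Xs.take (k + 1)) (fs.take k) * fs.getD k 1 *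
          Φ (interWord (Xs.drop (k + 1)) (fs.drop (k + 1)))) + bt Xs fs

/-- Two subalgebras `A1, A2` of `𝔄` are boolean independent over `𝔅` (with respect
to the conditional expectation `Φ`) if for every nonempty alternating word
(consecutive letters lying in different subalgebras among `A1`, `A2`), `Φ` of the
product is the ordered product of the individual `Φ`-values. -/
def BooleanIndepOver {A : Type*} [Ring A] [Algebra ℂ A]
    (Φ : A →ₗ[ℂ] A) (A1 A2 : NonUnitalSubalgebra ℂ A) : Prop :=
  ∀ l : List A, l ≠ [] →
    (∀ x ∈ l, x ∈ A1 ∨ x ∈ A2) →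
    l.Chain' (fun x y => (x ∈ A1 ∧ y ∈ A2) ∨ (x ∈ A2 ∧ y ∈ A1)) →
    Φ l.prod = (l.map Φ).prod

theorem interWord_cons_cons {A : Type*} [Monoid A] (x f : A) (xs fs : List A) (hxs : xs ≠ []) :
    interWord (x :: xs) (f :: fs) = x * f * interWord xs fs := by
  cases xs with
  | nil => exact absurd rfl hxs
  | cons y ys => rfl

theorem interWord_append {A : Type*} [Monoid A] (u gs w hs : List A) (p : A)
    (hu : u.length = gs.length + 1) (hw : w ≠ []) :
    interWord (u ++ w) (gs ++ p :: hs) = interWord u gs * p * interWord w hs := by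
  induction gs generalizing u with
  | nil =>
    obtain ⟨x, rfl⟩ := List.length_eq_one_iff.mp hu
    simp [interWord, interWord_cons_cons x p w hs hw]
  | cons g gs ih =>
    cases u with
    | nil => simp at hu
    | cons x u =>
      have hu' : u.length = gs.length + 1 := by simpa using hu
      have hne : u ≠ [] := by
        rintro rfl
        simp at hu'
      rw [List.cons_append, List.cons_append, interWord_cons_cons _ _ _ _ (by simp [hne]),
        interWord_cons_cons _ _ _ _ hne, ih u hu']
      simp only [mul_assoc]

/-- The defining recurrence, with the sum split at the end of a prefix `u` of the lower
argument. -/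
theorem IsOpBooleanCumulant.map_interWord_append {A : Type*} [Ring A] [Algebra ℂ A]
    {B : Subalgebra ℂ A} {Φ : A →ₗ[ℂ] A} {bt : List A → List A → A}
    (hbt : IsOpBooleanCumulant B Φ bt) (u gs w hs : List A)
    (hu : u.length = gs.length + 1) (hw : w.length = hs.length)
    (hgs : ∀ g ∈ gs, g ∈ B) (hhs : ∀ g ∈ hs, g ∈ B) :
    Φ (interWord (u ++ w) (gs ++ hs)) =
      (∑ j ∈ Finset.range gs.length,
        bt (u.take (j + 1)) (gs.take j) * gs.getD j 1 *
          Φ (interWord (u.drop (j + 1) ++ w) (gs.drop (j + 1) ++ hs))) +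
      (∑ i ∈ Finset.range hs.length,
        bt (u ++ w.take i) (gs ++ hs.take i) * hs.getD i 1 *
          Φ (interWord (w.drop i) (hs.drop (i + 1)))) +
      bt (u ++ w) (gs ++ hs) := by
  rw [hbt (u ++ w) (gs ++ hs) (by simp; omega)
    (fun g hg => (List.mem_append.mp hg).elim (hgs g) (hhs g)),
    List.length_append, Finset.sum_range_add]
  congr 2
  · refine Finset.sum_congr rfl fun j hj => ?_
    have hj := Finset.mem_range.mp hj
    rw [List.take_append_of_le_length (by omega), List.take_append_of_le_length (by omega),
      List.drop_append_of_le_length (by omega), List.drop_append_of_le_length (by omega),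
      List.getD_append _ _ _ _ hj]
  · refine Finset.sum_congr rfl fun i _ => ?_
    have h : gs.length + i + 1 = u.length + i := by omega
    rw [List.getD_append_right _ _ _ _ (by omega), add_assoc gs.length i 1,
      List.drop_length_add_append, ← add_assoc, h, List.take_length_add_append,
      List.take_length_add_append, List.drop_length_add_append, Nat.add_sub_cancel_left]

/-- A boolean cumulant of order at least two vanishes when its last lower argument is a scalar. -/
theorem IsOpBooleanCumulant.apply_concat_eq_zero {A : Type*} [Ring A] [Algebra ℂ A]
    {B : Subalgebra ℂ A} {Φ : A →ₗ[ℂ] A} {bt : List A → List A → A}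
    (hbt : IsOpBooleanCumulant B Φ bt) (hΦid : ∀ b ∈ B, Φ b = b)
    (hΦmul : ∀ b ∈ B, ∀ a, Φ (a * b) = Φ a * b)
    (u gs : List A) (p f : A) (hu : u.length = gs.length + 1)
    (hgs : ∀ g ∈ gs, g ∈ B) (hp : p ∈ B) (hf : f ∈ B) :
    bt (u ++ [f]) (gs ++ [p]) = 0 := by
  have key : ∀ u gs : List A, u.length = gs.length + 1 →
      Φ (interWord (u ++ [f]) (gs ++ [p])) = Φ (interWord u gs) * p * f := by
    intro u gs hu
    rw [interWord_append u gs [f] [] p hu (by simp), interWord, hΦmul f hf, hΦmul p hp]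
  have h₁ := hbt.map_interWord_append u gs [f] [p] hu rfl hgs (by simpa using hp)
  have h₂ := hbt.map_interWord_append u gs [] [] hu rfl hgs (by simp)
  have hsum : (∑ j ∈ Finset.range gs.length,
        bt (u.take (j + 1)) (gs.take j) * gs.getD j 1 *
          Φ (interWord (u.drop (j + 1) ++ [f]) (gs.drop (j + 1) ++ [p]))) =
      (∑ j ∈ Finset.range gs.length,
        bt (u.take (j + 1)) (gs.take j) * gs.getD j 1 *
          Φ (interWord (u.drop (j + 1)) (gs.drop (j + 1)))) * p * f := by
    rw [Finset.sum_mul, Finset.sum_mul]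
    refine Finset.sum_congr rfl fun j hj => ?_
    have hj := Finset.mem_range.mp hj
    rw [key _ _ (by simp; omega)]
    simp only [mul_assoc]
  rw [key u gs hu, hsum] at h₁
  simp only [List.append_nil, List.length_nil, Finset.range_zero, Finset.sum_empty,
    add_zero] at h₂
  simp only [List.length_singleton, Finset.sum_range_one, List.take_zero, List.append_nil,
    List.getD_cons_zero, List.drop_zero, interWord, hΦid f hf, h₂, add_mul] at h₁
  exact left_eq_add.mp h₁

theorem IsOpBooleanCumulant.apply_insert_eq {A : Type*} [Ring A] [Algebra ℂ A]
    {B : Subalgebra ℂ A} {Φ : A →ₗ[ℂ] A} {bt : List A → List A → A}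
    (hbt : IsOpBooleanCumulant B Φ bt) (hΦid : ∀ b ∈ B, Φ b = b)
    (hΦbimod : ∀ b₁ ∈ B, ∀ b₂ ∈ B, ∀ a, Φ (b₁ * a * b₂) = b₁ * Φ a * b₂)
    (u gs v hs : List A) (p f q : A)
    (hu : u.length = gs.length + 1) (hv : v.length = hs.length + 1)
    (hgs : ∀ g ∈ gs, g ∈ B) (hhs : ∀ g ∈ hs, g ∈ B) (hp : p ∈ B) (hf : f ∈ B) (hq : q ∈ B) :
    bt (u ++ f :: v) (gs ++ p :: q :: hs) = bt (u ++ v) (gs ++ (p * f * q) :: hs) := by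
  induction hlen : hs.length using Nat.strong_induction_on generalizing v hs with
  | _ n ih =>
  subst hlen
  have hv0 : v ≠ [] := by
    rintro rfl
    simp at hv
  have hpfq : p * f * q ∈ B := B.mul_mem (B.mul_mem hp hf) hq
  have word : ∀ u gs : List A, u.length = gs.length + 1 →
      interWord (u ++ f :: v) (gs ++ p :: q :: hs) =
        interWord (u ++ v) (gs ++ (p * f * q) :: hs) := by
    intro u gs hu
    rw [interWord_append _ _ _ _ _ hu (by simp), interWord_append _ _ _ _ _ hu hv0,
      interWord_cons_cons _ _ _ _ hv0]
    simp only [mul_assoc]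
  have h₁ := hbt.map_interWord_append u gs (f :: v) (p :: q :: hs) hu (by simp [hv]) hgs
    (by simpa [hp, hq] using hhs)
  have h₂ := hbt.map_interWord_append u gs v ((p * f * q) :: hs) hu (by simp [hv]) hgs
    (by simpa [hpfq] using hhs)
  have hzero := hbt.apply_concat_eq_zero hΦid
    (fun b hb a => by simpa using hΦbimod 1 B.one_mem b hb a) u gs p f hu hgs hp hf
  have hscalar : Φ (interWord (f :: v) (q :: hs)) = f * q * Φ (interWord v hs) := by
    rw [interWord_cons_cons _ _ _ _ hv0]
    simpa using hΦbimod (f * q) (B.mul_mem hf hq) 1 B.one_mem (interWord v hs)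
  have hsum : ∀ j ∈ Finset.range gs.length,
      bt (u.take (j + 1)) (gs.take j) * gs.getD j 1 *
          Φ (interWord (u.drop (j + 1) ++ f :: v) (gs.drop (j + 1) ++ p :: q :: hs)) =
        bt (u.take (j + 1)) (gs.take j) * gs.getD j 1 *
          Φ (interWord (u.drop (j + 1) ++ v) (gs.drop (j + 1) ++ (p * f * q) :: hs)) := by
    intro j hj
    have hj := Finset.mem_range.mp hj
    rw [word _ _ (by simp; omega)]
  have hind : ∀ i ∈ Finset.range hs.length,
      bt (u ++ f :: v.take (i + 1)) (gs ++ p :: q :: hs.take i) * hs.getD i 1 *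
          Φ (interWord (v.drop (i + 1)) (hs.drop (i + 1))) =
        bt (u ++ v.take (i + 1)) (gs ++ (p * f * q) :: hs.take i) * hs.getD i 1 *
          Φ (interWord (v.drop (i + 1)) (hs.drop (i + 1))) := by
    intro i hi
    have hi := Finset.mem_range.mp hi
    rw [ih i hi (v.take (i + 1)) (hs.take i) (by simp; omega)
      (fun g hg => hhs g (List.mem_of_mem_take hg)) (by simp; omega)]
  rw [word u gs hu, h₂, Finset.sum_congr rfl hsum] at h₁
  simp only [List.length_cons, Finset.sum_range_succ', List.take_succ_cons, List.take_zero,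
    List.drop_succ_cons, List.drop_zero, List.getD_cons_succ, List.getD_cons_zero,
    List.append_nil, hzero, zero_mul, add_zero, hscalar] at h₁
  rw [Finset.sum_congr rfl hind] at h₁
  simp only [mul_assoc] at h₁ ⊢
  exact (add_left_cancel h₁).symm

/-- Proposition 4.3 (ii), second part: inserting `f ∈ 𝔅` in an interior position of
the lower argument merges the adjacent upper arguments:
`b̃^{n+1}_{X₁,…,X_k, f, X_{k+1},…,Xₙ}(f₁,…,f_k,f_{k+1},…,fₙ)
  = b̃^n_{X₁,…,Xₙ}(f₁,…,f_{k-1}, f_k ⬝ f ⬝ f_{k+1}, f_{k+2},…,fₙ)`.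
Here `u = (X₁,…,X_k)` and `v = (X_{k+1},…,Xₙ)` are nonempty,
`gs₁ = (f₁,…,f_{k-1})`, `p = f_k`, `q = f_{k+1}`, `gs₂ = (f_{k+2},…,fₙ)`. -/
theorem op_boolean_cumulant_scalar_interior
    {A : Type*} [Ring A] [Algebra ℂ A] (B : Subalgebra ℂ A)
    (Φ : A →ₗ[ℂ] A) (hΦmem : ∀ a, Φ a ∈ B) (hΦid : ∀ b ∈ B, Φ b = b)
    (hΦbimod : ∀ b₁ ∈ B, ∀ b₂ ∈ B, ∀ a, Φ (b₁ * a * b₂) = b₁ * Φ a * b₂)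
    (bt : List A → List A → A) (hbt : IsOpBooleanCumulant B Φ bt)
    (f : A) (hf : f ∈ B)
    (u v : List A) (hu : u ≠ []) (hv : v ≠ [])
    (gs₁ gs₂ : List A) (p q : A)
    (hlen₁ : gs₁.length = u.length - 1) (hlen₂ : gs₂.length = v.length - 1)
    (hgs₁ : ∀ g ∈ gs₁, g ∈ B) (hgs₂ : ∀ g ∈ gs₂, g ∈ B) (hp : p ∈ B) (hq : q ∈ B) :
    bt (u ++ f :: v) (gs₁ ++ p :: q :: gs₂) =
      bt (u ++ v) (gs₁ ++ (p * f * q) :: gs₂) := by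
  have hu' := List.length_pos_iff.mpr hu
  have hv' := List.length_pos_iff.mpr hv
  exact hbt.apply_insert_eq hΦid hΦbimod u gs₁ v gs₂ p f q (by omega) (by omega)
    hgs₁ hgs₂ hp hf hq
end
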